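/- Let Λ ⊂ ℝ^{2d} be a lattice, g ∈ S(ℝ^d) generating a Gabor frame G(g,Λ) for L²(ℝ^d), m, r ∈ ℝ, 0 < p, q ≤ ∞, and τ ∈ [0,1]. If σ ∈ S^m(ℝ^{2d}), then Op_τ(σ) extends to a bounded operator from M^{p,q}_{⟨·⟩^{r+m}}(ℝ^d) to M^{p,q}_{⟨·⟩^{r}}(ℝ^d), with operator norm bounded uniformly in τ ∈ [0,1]. -/

import Mathlib

open scoped Real BigOperators
open Complex MeasureTheory

noncomputable section

variable {d : ℕ}

/-- The Japanese bracket on phase space `ℝ^{2d} = ℝ^d × ℝ^d` (Euclidean norm). -/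
def jb2 (w : (Fin d → ℝ) × (Fin d → ℝ)) : ℝ :=
  Real.sqrt (1 + ∑ i, (w.1 i) ^ 2 + ∑ i, (w.2 i) ^ 2)

/-- Directional derivative operator. -/
def pdir {E : Type*} [NormedAddCommGroup E] [NormedSpace ℝ E] (v : E) (h : E → ℂ) : E → ℂ :=
  fun y => fderiv ℝ h y v

/-- Iterated directional derivatives along a list of directions. -/
def mpdList {E : Type*} [NormedAddCommGroup E] [NormedSpace ℝ E]
    (vs : List E) (h : E → ℂ) : E → ℂ :=
  vs.foldr pdir h

/-- The list of coordinate directions encoding the multi-index `α`. -/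
def stdList (d : ℕ) (α : Fin d → ℕ) : List (Fin d → ℝ) :=
  (List.finRange d).flatMap fun i => List.replicate (α i) (Pi.single i 1)

/-- Directions on phase space encoding a multi-index on `ℝ^{2d}`. -/
def stdList2 (d : ℕ) (α : (Fin d → ℕ) × (Fin d → ℕ)) :
    List ((Fin d → ℝ) × (Fin d → ℝ)) :=
  ((stdList d α.1).map fun v => (v, 0)) ++ ((stdList d α.2).map fun v => (0, v))

/-- The multi-index partial derivative `∂^α` on phase space. -/
def mpd2 (α : (Fin d → ℕ) × (Fin d → ℕ)) (h : (Fin d → ℝ) × (Fin d → ℝ) → ℂ) :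
    (Fin d → ℝ) × (Fin d → ℝ) → ℂ :=
  mpdList (stdList2 d α) h

/-- The Hörmander-type symbol class `S^m(ℝ^{2d})`. -/
def SmSymbol (d : ℕ) (m : ℝ) (σ : (Fin d → ℝ) × (Fin d → ℝ) → ℂ) : Prop :=
  ContDiff ℝ (⊤ : ℕ∞) σ ∧
    ∀ α : (Fin d → ℕ) × (Fin d → ℕ), ∃ C : ℝ, ∀ z, ‖mpd2 α σ z‖ ≤ C * jb2 z ^ m

/-- The seminorm `|σ|_{n,m} = sup_{|α| ≤ n} sup_z |∂^α σ(z)| ⟨z⟩^{-m}`. -/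
def smSeminorm (d : ℕ) (n : ℕ) (m : ℝ) (σ : (Fin d → ℝ) × (Fin d → ℝ) → ℂ) : ℝ :=
  sSup {r | ∃ α : (Fin d → ℕ) × (Fin d → ℕ), ∃ z,
    (∑ i, α.1 i) + (∑ i, α.2 i) ≤ n ∧ r = ‖mpd2 α σ z‖ * jb2 z ^ (-m)}

/-- The time-frequency shift `π(x,ω)f(t) = e^{2πiωt} f(t-x)`. -/
def tshift (w : (Fin d → ℝ) × (Fin d → ℝ)) (g : (Fin d → ℝ) → ℂ) :
    (Fin d → ℝ) → ℂ :=
  fun t => Complex.exp (2 * π * Complex.I * (∑ i, w.2 i * t i)) * g (t - w.1)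

/-- The cross-τ-Wigner distribution. -/
def wig (τ : ℝ) (f h : (Fin d → ℝ) → ℂ) : (Fin d → ℝ) × (Fin d → ℝ) → ℂ :=
  fun p => ∫ y : Fin d → ℝ,
    Complex.exp (-(2 * π * Complex.I * (∑ i, y i * p.2 i))) * f (p.1 + τ • y) *
      (starRingEnd ℂ) (h (p.1 - (1 - τ) • y))


/-- The short-time Fourier transform on `ℝ^d`. -/
def stft (g f : (Fin d → ℝ) → ℂ) (x ω : Fin d → ℝ) : ℂ :=
  ∫ y : Fin d → ℝ,
    Complex.exp (-(2 * π * Complex.I * (∑ i, ω i * y i))) * f y *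
      (starRingEnd ℂ) (g (y - x))

/-- The STFT (with window `g`) of `Op_τ(σ) f`, computed via the weak definition
`V_g(Op_τ(σ)f)(x,ω) = ⟨Op_τ(σ)f, M_ω T_x g⟩ = ⟨σ, W_τ(M_ω T_x g, f)⟩`. -/
def vOpTau (τ : ℝ) (σ : (Fin d → ℝ) × (Fin d → ℝ) → ℂ) (g f : (Fin d → ℝ) → ℂ)
    (x ω : Fin d → ℝ) : ℂ :=
  ∫ p : (Fin d → ℝ) × (Fin d → ℝ),
    σ p * (starRingEnd ℂ) (wig τ (tshift (x, ω) g) f p)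

open scoped ENNReal in
/-- The (quasi-)norm of the modulation space `M^{p,q}_{⟨·⟩^r}(ℝ^d)` (with weight
`w(x,ω) = ⟨(x,ω)⟩^r`) of a generalized STFT `V`, for `0 < p,q ≤ ∞`. -/
def mixedModNorm (p q : ℝ≥0∞) (r : ℝ) (V : (Fin d → ℝ) → (Fin d → ℝ) → ℂ) : ℝ≥0∞ :=
  if q = ∞ then
    ⨆ ω, (if p = ∞ then
        ⨆ x, (‖V x ω‖₊ : ℝ≥0∞) * ENNReal.ofReal (jb2 (x, ω) ^ r)
      else
        (∫⁻ x : Fin d → ℝ,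
          ((‖V x ω‖₊ : ℝ≥0∞) * ENNReal.ofReal (jb2 (x, ω) ^ r)) ^ p.toReal) ^ (1 / p.toReal))
  else
    (∫⁻ ω : Fin d → ℝ,
      (if p = ∞ then
          ⨆ x, (‖V x ω‖₊ : ℝ≥0∞) * ENNReal.ofReal (jb2 (x, ω) ^ r)
        else
          (∫⁻ x : Fin d → ℝ,
            ((‖V x ω‖₊ : ℝ≥0∞) * ENNReal.ofReal (jb2 (x, ω) ^ r)) ^ p.toReal) ^
              (1 / p.toReal)) ^ q.toReal) ^ (1 / q.toReal)

section BoundednessProof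

open scoped ENNReal SchwartzMap

/-- The `L^P` (quasi-)norm of a nonnegative function, with a true supremum for `P = ∞`. -/
def lpn (P : ℝ≥0∞) (φ : (Fin d → ℝ) → ℝ≥0∞) : ℝ≥0∞ :=
  if P = ∞ then ⨆ x, φ x else (∫⁻ x, φ x ^ P.toReal) ^ (1 / P.toReal)

theorem mixedModNorm_eq_lpn (p q : ℝ≥0∞) (r : ℝ) (V : (Fin d → ℝ) → (Fin d → ℝ) → ℂ) :
    mixedModNorm p q r V =
      lpn q fun ω => lpn p fun x => (‖V x ω‖₊ : ℝ≥0∞) * ENNReal.ofReal (jb2 (x, ω) ^ r) := rfl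

theorem lpn_mono (P : ℝ≥0∞) {φ ψ : (Fin d → ℝ) → ℝ≥0∞} (h : ∀ x, φ x ≤ ψ x) :
    lpn P φ ≤ lpn P ψ := by
  unfold lpn
  split_ifs
  · exact iSup_mono h
  · gcongr
    exact h _

theorem lpn_const_mul {P : ℝ≥0∞} (hP : P ≠ 0) {c : ℝ≥0∞} (hc : c ≠ ∞)
    (φ : (Fin d → ℝ) → ℝ≥0∞) : lpn P (fun x => c * φ x) = c * lpn P φ := by
  unfold lpn
  split_ifs with h
  · rw [ENNReal.mul_iSup]
  · have hp : 0 < P.toReal := ENNReal.toReal_pos hP h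
    simp_rw [ENNReal.mul_rpow_of_nonneg _ _ hp.le]
    rw [lintegral_const_mul' _ _ (by simp [hp.le, hc]),
      ENNReal.mul_rpow_of_nonneg _ _ (by positivity), ← ENNReal.rpow_mul,
      mul_one_div_cancel hp.ne', ENNReal.rpow_one]

theorem lpn_rpow {P : ℝ≥0∞} (hP : P ≠ 0) {s : ℝ} (hs : 0 < s) (φ : (Fin d → ℝ) → ℝ≥0∞) :
    lpn P φ ^ s = lpn (P / ENNReal.ofReal s) fun x => φ x ^ s := by
  have h0 : ENNReal.ofReal s ≠ 0 := by simpa using hs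
  unfold lpn
  by_cases h : P = ∞
  · have : P / ENNReal.ofReal s = ∞ := by rw [h, ENNReal.top_div_of_ne_top ENNReal.ofReal_ne_top]
    rw [if_pos h, if_pos this]
    exact (ENNReal.orderIsoRpow s hs).map_iSup φ
  · have : P / ENNReal.ofReal s ≠ ∞ := ENNReal.div_ne_top h h0
    have hp : 0 < P.toReal := ENNReal.toReal_pos hP h
    rw [if_neg h, if_neg this, ← ENNReal.rpow_mul, ENNReal.toReal_div,
      ENNReal.toReal_ofReal hs.le]
    simp_rw [← ENNReal.rpow_mul]
    have e1 : 1 / P.toReal * s = 1 / (P.toReal / s) := by field_simp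
    have e2 : s * (P.toReal / s) = P.toReal := by field_simp
    rw [e1, e2]

theorem lpn_comp_sub_right (P : ℝ≥0∞) (φ : (Fin d → ℝ) → ℝ≥0∞) (h : Fin d → ℝ) :
    lpn P (fun x => φ (x - h)) = lpn P φ := by
  unfold lpn
  split_ifs
  · exact (Equiv.subRight h).iSup_comp (g := φ)
  · rw [lintegral_sub_right_eq_self (fun x => φ x ^ P.toReal) h]

theorem lpn_lintegral_le_of_truncation {p : ℝ} (hp : 1 < p)
    {u : (Fin d → ℝ) → (Fin d → ℝ) → ℝ≥0∞} (hu : Measurable (Function.uncurry u))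
    {T : (Fin d → ℝ) → ℝ≥0∞} (hT : Measurable T) (hTS : ∀ x, T x ≤ ∫⁻ y, u y x)
    (hfin : ∫⁻ x, T x ^ p ≠ ∞) :
    ∫⁻ x, T x ^ p ≤ (∫⁻ y, (∫⁻ x, u y x ^ p) ^ (1 / p)) ^ p := by
  have hp0 : 0 < p := by linarith
  obtain ⟨q, hpq⟩ : ∃ q, p.HolderConjugate q := ⟨_, Real.HolderConjugate.conjExponent hp⟩
  have key : ∫⁻ x, T x ^ p ≤
      (∫⁻ y, (∫⁻ x, u y x ^ p) ^ (1 / p)) * (∫⁻ x, T x ^ p) ^ (1 / q) := by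
    calc ∫⁻ x, T x ^ p ≤ ∫⁻ x, ∫⁻ y, u y x * T x ^ (p - 1) := by
          refine lintegral_mono fun x => ?_
          rw [lintegral_mul_const (f := fun y => u y x) _ (hu.comp measurable_prodMk_right)]
          calc T x ^ p = T x * T x ^ (p - 1) := by
                conv_rhs => enter [1]; rw [← ENNReal.rpow_one (T x)]
                rw [← ENNReal.rpow_add_of_nonneg _ _ zero_le_one (by linarith)]
                congr 1; ring
            _ ≤ _ := by gcongr; exact hTS x
      _ = ∫⁻ y, ∫⁻ x, u y x * T x ^ (p - 1) := by
          refine lintegral_lintegral_swap (f := fun x y => u y x * T x ^ (p - 1)) ?_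
          refine Measurable.aemeasurable ?_
          exact (hu.comp measurable_swap).mul ((hT.comp measurable_fst).pow_const _)
      _ ≤ ∫⁻ y, (∫⁻ x, u y x ^ p) ^ (1 / p) * (∫⁻ x, T x ^ p) ^ (1 / q) := by
          refine lintegral_mono fun y => ?_
          exact ENNReal.lintegral_mul_rpow_le_lintegral_rpow_mul_lintegral_rpow hpq
            (hu.comp measurable_prodMk_left).aemeasurable hT.aemeasurable
      _ = _ := by
          rw [lintegral_mul_const' _ _ (ENNReal.rpow_ne_top_of_nonneg (by
            have := hpq.symm.pos; positivity) hfin)]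
  by_cases h0 : ∫⁻ x, T x ^ p = 0
  · rw [h0]; exact zero_le
  set I := ∫⁻ x, T x ^ p
  set R := ∫⁻ y, (∫⁻ x, u y x ^ p) ^ (1 / p)
  have h1 : I ^ (1 / p) ≤ R := by
    have e : I = I ^ (1 / p) * I ^ (1 / q) := by
      rw [← ENNReal.rpow_add _ _ h0 hfin]
      have := hpq.inv_add_inv_eq_one
      simp [this]
    have hne : I ^ (1 / q) ≠ 0 := by simp [h0, hfin]
    have hnt : I ^ (1 / q) ≠ ∞ := ENNReal.rpow_ne_top_of_nonneg (by
            have := hpq.symm.pos; positivity) hfin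
    rw [e] at key
    rw [← e] at key
    exact (ENNReal.mul_le_mul_iff_left hne hnt).1 (e ▸ key)
  calc I = (I ^ (1 / p)) ^ p := by
        rw [← ENNReal.rpow_mul, one_div_mul_cancel hp0.ne', ENNReal.rpow_one]
    _ ≤ R ^ p := by gcongr

/-- Minkowski's integral inequality. -/
theorem lpn_lintegral_le {P : ℝ≥0∞} (hP : 1 ≤ P)
    {u : (Fin d → ℝ) → (Fin d → ℝ) → ℝ≥0∞} (hu : Measurable (Function.uncurry u)) :
    lpn P (fun x => ∫⁻ y, u y x) ≤ ∫⁻ y, lpn P (u y) := by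
  unfold lpn
  split_ifs with h
  · exact iSup_le fun x => lintegral_mono fun y => le_iSup (u y) x
  have h1 : 1 ≤ P.toReal := by
    rw [← ENNReal.toReal_one]; exact ENNReal.toReal_mono h hP
  set p := P.toReal
  rcases h1.eq_or_lt with h1 | h1
  · rw [← h1]
    simp only [ENNReal.rpow_one, div_one]
    rw [lintegral_lintegral_swap]
    exact (hu.comp measurable_swap).aemeasurable
  have hp0 : 0 < p := by linarith
  set S : (Fin d → ℝ) → ℝ≥0∞ := fun x => ∫⁻ y, u y x with hS
  have hSm : Measurable S := by
    exact Measurable.lintegral_prod_right (f := fun x y => u y x) (hu.comp measurable_swap)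
  let T : ℕ → (Fin d → ℝ) → ℝ≥0∞ := fun n =>
    (Metric.closedBall 0 n).indicator fun x => min (S x) n
  have hTm : ∀ n, Measurable (T n) := fun n =>
    (hSm.min measurable_const).indicator Metric.isClosed_closedBall.measurableSet
  have hTS : ∀ n x, T n x ≤ S x := fun n x =>
    (Set.indicator_le_self' (fun _ _ => zero_le) x).trans (min_le_left _ _)
  have hfin : ∀ n, ∫⁻ x, T n x ^ p ≠ ∞ := by
    intro n
    have : ∀ x, T n x ^ p ≤ (Metric.closedBall 0 (n : ℝ)).indicator (fun _ => (n : ℝ≥0∞) ^ p) x := by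
      intro x
      by_cases hx : x ∈ Metric.closedBall (0 : Fin d → ℝ) (n : ℝ)
      · simp only [T, Set.indicator_of_mem hx]
        gcongr
        exact min_le_right _ _
      · simp [T, Set.indicator_of_notMem hx, hp0]
    refine ((lintegral_mono this).trans_lt ?_).ne
    rw [lintegral_indicator Metric.isClosed_closedBall.measurableSet, lintegral_const]
    refine ENNReal.mul_lt_top (ENNReal.rpow_lt_top_of_nonneg hp0.le (by simp)) ?_
    rw [Measure.restrict_apply_univ]
    exact measure_closedBall_lt_top
  have hmono : Monotone T := by
    intro n k hnk x
    have hnk' : (n : ℝ) ≤ k := by exact_mod_cast hnk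
    by_cases hx : x ∈ Metric.closedBall (0 : Fin d → ℝ) (n : ℝ)
    · simp only [T]
      rw [Set.indicator_of_mem hx, Set.indicator_of_mem (Metric.closedBall_subset_closedBall hnk' hx)]
      gcongr
    · simp [T, Set.indicator_of_notMem hx]
  have hsup : ∀ x, S x ^ p = ⨆ n, T n x ^ p := by
    intro x
    have e1 : S x = ⨆ n, T n x := by
      refine le_antisymm ?_ (iSup_le fun n => hTS n x)
      refine le_of_forall_lt fun c hc => ?_
      obtain ⟨n1, hn1⟩ := ENNReal.exists_nat_gt (hc.trans_le le_top).ne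
      obtain ⟨n2, hn2⟩ := exists_nat_ge ‖x‖
      refine lt_of_lt_of_le ?_ (le_iSup _ (max n1 n2))
      have hx : x ∈ Metric.closedBall (0 : Fin d → ℝ) ((max n1 n2 : ℕ) : ℝ) := by
        rw [mem_closedBall_zero_iff]
        exact hn2.trans (by exact_mod_cast le_max_right _ _)
      simp only [T]
      rw [Set.indicator_of_mem hx]
      refine lt_min hc (hn1.trans_le (by exact_mod_cast le_max_left _ _))
    rw [e1]
    exact (ENNReal.orderIsoRpow p hp0).map_iSup _
  have : ∫⁻ x, S x ^ p ≤ (∫⁻ y, (∫⁻ x, u y x ^ p) ^ (1 / p)) ^ p := by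
    simp_rw [hsup]
    rw [lintegral_iSup (fun n => (hTm n).pow_const _)
      (fun n k hnk x => ENNReal.rpow_le_rpow (hmono hnk x) hp0.le)]
    exact iSup_le fun n => lpn_lintegral_le_of_truncation h1 hu (hTm n) (hTS n) (hfin n)
  calc (∫⁻ x, S x ^ p) ^ (1 / p) ≤ ((∫⁻ y, (∫⁻ x, u y x ^ p) ^ (1 / p)) ^ p) ^ (1 / p) := by
        gcongr
    _ = _ := by rw [← ENNReal.rpow_mul, mul_one_div_cancel hp0.ne', ENNReal.rpow_one]

theorem measurable_lpn (P : ℝ≥0∞) {a : (Fin d → ℝ) → (Fin d → ℝ) → ℝ≥0∞}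
    (ha : Continuous (Function.uncurry a)) : Measurable fun ω => lpn P fun x => a x ω := by
  unfold lpn
  split_ifs with h
  · refine LowerSemicontinuous.measurable ?_
    refine lowerSemicontinuous_iSup fun x => Continuous.lowerSemicontinuous ?_
    exact ha.comp (Continuous.prodMk_right x)
  · refine Measurable.pow_const ?_ _
    refine Measurable.lintegral_prod_right (f := fun ω x => a x ω ^ P.toReal) ?_
    exact (ha.measurable.comp measurable_swap).pow_const _

/-- Young's inequality for convolution with an integrable product kernel on mixed-norm spaces. -/
theorem lpn_lpn_conv_le {P Q : ℝ≥0∞} (hP : 1 ≤ P) (hQ : 1 ≤ Q) {k : (Fin d → ℝ) → ℝ≥0∞}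
    (hk : Measurable k) (hk' : ∀ x, k x ≠ ∞) {a : (Fin d → ℝ) → (Fin d → ℝ) → ℝ≥0∞}
    (hkf : ∫⁻ x, k x ≠ ∞)
    (ha : Continuous (Function.uncurry a)) :
    lpn Q (fun ω => lpn P fun x => ∫⁻ η, k η * ∫⁻ h, k h * a (x - h) (ω - η)) ≤
      (∫⁻ x, k x) * (∫⁻ x, k x) * lpn Q fun ω => lpn P fun x => a x ω := by
  have hP0 : P ≠ 0 := (zero_lt_one.trans_le hP).ne'
  have hQ0 : Q ≠ 0 := (zero_lt_one.trans_le hQ).ne'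
  set N : (Fin d → ℝ) → ℝ≥0∞ := fun ω => lpn P fun x => a x ω with hN
  have hNm : Measurable N := measurable_lpn P ha
  have step1 : ∀ ω, (lpn P fun x => ∫⁻ η, k η * ∫⁻ h, k h * a (x - h) (ω - η)) ≤
      (∫⁻ x, k x) * ∫⁻ η, k η * N (ω - η) := by
    intro ω
    have hmeas : Measurable fun z : ((Fin d → ℝ) × (Fin d → ℝ)) × (Fin d → ℝ) =>
        k z.2 * a (z.1.2 - z.2) (ω - z.1.1) := by
      refine (hk.comp measurable_snd).mul ?_
      refine ha.measurable.comp (f := fun z : ((Fin d → ℝ) × (Fin d → ℝ)) × (Fin d → ℝ) =>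
        (z.1.2 - z.2, ω - z.1.1)) ?_
      fun_prop
    calc (lpn P fun x => ∫⁻ η, k η * ∫⁻ h, k h * a (x - h) (ω - η))
        ≤ ∫⁻ η, lpn P fun x => k η * ∫⁻ h, k h * a (x - h) (ω - η) := by
          refine lpn_lintegral_le (u := fun η x => k η * ∫⁻ h, k h * a (x - h) (ω - η)) hP ?_
          refine (hk.comp measurable_fst).mul ?_
          exact Measurable.lintegral_prod_right (f := fun (z : (Fin d → ℝ) × (Fin d → ℝ)) h =>
            k h * a (z.2 - h) (ω - z.1)) hmeas
      _ ≤ ∫⁻ η, k η * ((∫⁻ x, k x) * N (ω - η)) := by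
          refine lintegral_mono fun η => ?_
          rw [lpn_const_mul hP0 (hk' η)]
          gcongr
          calc (lpn P fun x => ∫⁻ h, k h * a (x - h) (ω - η))
              ≤ ∫⁻ h, lpn P fun x => k h * a (x - h) (ω - η) := by
                refine lpn_lintegral_le (u := fun h x => k h * a (x - h) (ω - η)) hP ?_
                refine (hk.comp measurable_fst).mul ?_
                refine ha.measurable.comp (f := fun z : (Fin d → ℝ) × (Fin d → ℝ) =>
                  (z.2 - z.1, ω - η)) ?_
                fun_prop
            _ = ∫⁻ h, k h * N (ω - η) := by
                refine lintegral_congr fun h => ?_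
                rw [lpn_const_mul hP0 (hk' h),
                  lpn_comp_sub_right P (fun x => a x (ω - η)) h]
            _ = _ := lintegral_mul_const _ hk
      _ = _ := by
          rw [← lintegral_const_mul' _ _ hkf]
          refine lintegral_congr fun η => ?_
          ring
  calc _ ≤ lpn Q fun ω => (∫⁻ x, k x) * ∫⁻ η, k η * N (ω - η) := lpn_mono Q step1
    _ = (∫⁻ x, k x) * lpn Q fun ω => ∫⁻ η, k η * N (ω - η) := lpn_const_mul hQ0 hkf _
    _ ≤ (∫⁻ x, k x) * ∫⁻ η, lpn Q fun ω => k η * N (ω - η) := by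
        gcongr
        refine lpn_lintegral_le (u := fun η ω => k η * N (ω - η)) hQ ?_
        refine (hk.comp measurable_fst).mul ?_
        exact hNm.comp (measurable_snd.sub measurable_fst)
    _ = (∫⁻ x, k x) * ∫⁻ η, k η * lpn Q N := by
        congr 1
        refine lintegral_congr fun h => ?_
        rw [lpn_const_mul hQ0 (hk' h), lpn_comp_sub_right Q N h]
    _ = _ := by rw [lintegral_mul_const _ hk, mul_assoc]

/-- The polynomially decaying function `(1 + ‖x‖)^{-N}` with values in `[0, ∞]`. -/
def dec {X : Type*} [Norm X] (N : ℝ) (x : X) : ℝ≥0∞ := ENNReal.ofReal ((1 + ‖x‖) ^ (-N))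

section Dec
variable {X : Type*} [NormedAddCommGroup X]

theorem dec_ne_top (N : ℝ) (x : X) : dec N x ≠ ∞ := ENNReal.ofReal_ne_top

theorem dec_add (N M : ℝ) (x : X) : dec (N + M) x = dec N x * dec M x := by
  have : 0 < 1 + ‖x‖ := by positivity
  unfold dec
  rw [← ENNReal.ofReal_mul (by positivity), ← Real.rpow_add this, neg_add]

theorem dec_rpow (N : ℝ) {s : ℝ} (hs : 0 ≤ s) (x : X) : dec N x ^ s = dec (N * s) x := by
  unfold dec
  rw [ENNReal.ofReal_rpow_of_nonneg (by positivity) hs, ← Real.rpow_mul (by positivity), neg_mul]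

theorem dec_mul_dec_le {N : ℝ} (hN : 0 ≤ N) (x y : X) : dec N x * dec N y ≤ dec N (x + y) := by
  unfold dec
  rw [← ENNReal.ofReal_mul (by positivity), ← Real.mul_rpow (by positivity) (by positivity)]
  refine ENNReal.ofReal_le_ofReal (Real.rpow_le_rpow_of_nonpos (by positivity) ?_ (by linarith))
  nlinarith [norm_add_le x y, norm_nonneg x, norm_nonneg y]

theorem dec_prod_le {Y : Type*} [NormedAddCommGroup Y] {N : ℝ} (hN : 0 ≤ N) (x : X) (y : Y) :
    dec (N + N) (x, y) ≤ dec N x * dec N y := by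
  rw [dec_add]
  have h : ∀ {a b : ℝ}, 0 ≤ a → a ≤ b → (1 + b) ^ (-N) ≤ (1 + a) ^ (-N) := fun ha hab =>
    Real.rpow_le_rpow_of_nonpos (by positivity) (by linarith) (by linarith)
  exact mul_le_mul' (ENNReal.ofReal_le_ofReal (h (norm_nonneg _) (norm_fst_le (x, y))))
    (ENNReal.ofReal_le_ofReal (h (norm_nonneg _) (norm_snd_le (x, y))))

theorem measurable_dec [MeasurableSpace X] [BorelSpace X] (N : ℝ) :
    Measurable (dec N : X → ℝ≥0∞) := by
  unfold dec
  fun_prop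

end Dec

theorem lintegral_dec_ne_top {N : ℝ} (hN : d < N) : ∫⁻ x : Fin d → ℝ, dec N x ≠ ∞ :=
  (finite_integral_one_add_norm (μ := volume) (E := Fin d → ℝ) (by simpa using hN)).ne

theorem jb2_pos (z : (Fin d → ℝ) × (Fin d → ℝ)) : 0 < jb2 z := by
  unfold jb2
  have h1 : 0 ≤ ∑ i, (z.1 i) ^ 2 := Finset.sum_nonneg fun i _ => sq_nonneg _
  have h2 : 0 ≤ ∑ i, (z.2 i) ^ 2 := Finset.sum_nonneg fun i _ => sq_nonneg _
  exact Real.sqrt_pos.2 (by positivity)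

theorem continuous_jb2 : Continuous (jb2 : (Fin d → ℝ) × (Fin d → ℝ) → ℝ) := by
  unfold jb2
  fun_prop

theorem jb2_le (z : (Fin d → ℝ) × (Fin d → ℝ)) : jb2 z ≤ (1 + 2 * d) * (1 + ‖z‖) := by
  unfold jb2
  refine Real.sqrt_le_iff.2 ⟨by positivity, ?_⟩
  have hb : ∀ x : Fin d → ℝ, ‖x‖ ≤ ‖z‖ → ∑ i, (x i) ^ 2 ≤ d * ‖z‖ ^ 2 := by
    intro x hx
    calc ∑ i, (x i) ^ 2 ≤ ∑ _i : Fin d, ‖z‖ ^ 2 := by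
          refine Finset.sum_le_sum fun i _ => ?_
          rw [← sq_abs (x i)]
          exact pow_le_pow_left₀ (abs_nonneg _) ((norm_le_pi_norm x i).trans hx) 2
      _ = _ := by simp
  have h1 := hb z.1 (norm_fst_le z)
  have h2 := hb z.2 (norm_snd_le z)
  have hz := norm_nonneg z
  have hd : (0 : ℝ) ≤ d := Nat.cast_nonneg d
  have : (1 + 2 * (d : ℝ)) * (1 + ‖z‖) ^ 2 ≤ ((1 + 2 * (d : ℝ)) * (1 + ‖z‖)) ^ 2 := by
    rw [mul_pow]
    gcongr
    nlinarith
  nlinarith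

theorem one_add_norm_le_jb2 (z : (Fin d → ℝ) × (Fin d → ℝ)) : 1 + ‖z‖ ≤ 2 * jb2 z := by
  have hs : ∀ x : Fin d → ℝ, 0 ≤ ∑ i, (x i) ^ 2 := fun x => Finset.sum_nonneg fun i _ => sq_nonneg _
  have h1 : 1 ≤ jb2 z := by
    unfold jb2
    exact Real.one_le_sqrt.2 (by linarith [hs z.1, hs z.2])
  have hx : ∀ x : Fin d → ℝ, ∑ i, (x i) ^ 2 ≤ jb2 z ^ 2 → ‖x‖ ≤ jb2 z := by
    intro x hx
    refine (pi_norm_le_iff_of_nonneg (jb2_pos z).le).2 fun i => ?_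
    refine abs_le_of_sq_le_sq ?_ (jb2_pos z).le
    exact (Finset.single_le_sum (f := fun i => (x i) ^ 2) (fun i _ => sq_nonneg _)
      (Finset.mem_univ i)).trans hx
  have hsq : jb2 z ^ 2 = 1 + ∑ i, (z.1 i) ^ 2 + ∑ i, (z.2 i) ^ 2 := by
    unfold jb2
    exact Real.sq_sqrt (by linarith [hs z.1, hs z.2])
  have h2 : ‖z‖ ≤ jb2 z := by
    rw [Prod.norm_def]
    exact max_le (hx _ (by linarith [hs z.2])) (hx _ (by linarith [hs z.1]))
  linarith

/-- Peetre's inequality. -/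
theorem jb2_rpow_le (ρ : ℝ) (z w : (Fin d → ℝ) × (Fin d → ℝ)) :
    jb2 z ^ ρ ≤ (2 * (1 + 2 * d)) ^ |ρ| * (jb2 w ^ ρ * (1 + ‖z - w‖) ^ |ρ|) := by
  have base : ∀ z w : (Fin d → ℝ) × (Fin d → ℝ),
      jb2 z ≤ 2 * (1 + 2 * d) * jb2 w * (1 + ‖z - w‖) := by
    intro z w
    calc jb2 z ≤ (1 + 2 * d) * (1 + ‖z‖) := jb2_le z
      _ ≤ (1 + 2 * d) * ((1 + ‖w‖) * (1 + ‖z - w‖)) := by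
          gcongr
          have : ‖z‖ ≤ ‖w‖ + ‖z - w‖ := by simpa using norm_add_le w (z - w)
          nlinarith [norm_nonneg w, norm_nonneg (z - w)]
      _ ≤ (1 + 2 * d) * ((2 * jb2 w) * (1 + ‖z - w‖)) := by
          gcongr
          exact one_add_norm_le_jb2 w
      _ = _ := by ring
  have hz := jb2_pos z
  have hw := jb2_pos w
  rcases le_total 0 ρ with h | h
  · rw [abs_of_nonneg h]
    calc jb2 z ^ ρ ≤ (2 * (1 + 2 * d) * jb2 w * (1 + ‖z - w‖)) ^ ρ :=
          Real.rpow_le_rpow hz.le (base z w) h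
      _ = _ := by
          rw [Real.mul_rpow (by positivity) (by positivity),
            Real.mul_rpow (by positivity) (by positivity), mul_assoc]
  · rw [abs_of_nonpos h]
    have h1 : jb2 w ^ (-ρ) ≤ (2 * (1 + 2 * d) * jb2 z * (1 + ‖w - z‖)) ^ (-ρ) :=
      Real.rpow_le_rpow hw.le (base w z) (by linarith)
    rw [Real.mul_rpow (by positivity) (by positivity),
      Real.mul_rpow (by positivity) (by positivity), norm_sub_rev] at h1
    have h2 : jb2 z ^ ρ * jb2 z ^ (-ρ) = 1 := by
      rw [← Real.rpow_add hz]; simp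
    have h3 : jb2 w ^ ρ * jb2 w ^ (-ρ) = 1 := by
      rw [← Real.rpow_add hw]; simp
    have hz' : 0 < jb2 z ^ ρ := by positivity
    have hw' : 0 < jb2 w ^ ρ := by positivity
    calc jb2 z ^ ρ = jb2 z ^ ρ * jb2 w ^ ρ * jb2 w ^ (-ρ) := by rw [mul_assoc, h3, mul_one]
      _ ≤ jb2 z ^ ρ * jb2 w ^ ρ * ((2 * (1 + 2 * d)) ^ (-ρ) * jb2 z ^ (-ρ) *
          (1 + ‖z - w‖) ^ (-ρ)) := by gcongr
      _ = (jb2 z ^ ρ * jb2 z ^ (-ρ)) * ((2 * (1 + 2 * d)) ^ (-ρ) * (jb2 w ^ ρ *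
          (1 + ‖z - w‖) ^ (-ρ))) := by ring
      _ = _ := by rw [h2, one_mul]

/-- A function controlled by its own average against a polynomially decaying kernel satisfies the
same control with `F ^ s` in place of `F`, for every `0 < s ≤ 1`. -/
theorem rpow_lintegral_dec_le {F : (Fin d → ℝ) × (Fin d → ℝ) → ℝ≥0∞}
    {M : ℝ} (hM : 0 ≤ M) {C : ℝ≥0∞} (hC : C ≠ ∞)
    (hfin : ∫⁻ w, F w ≠ ∞) (hrep : ∀ z, F z ≤ C * ∫⁻ w, F w * dec M (z - w))
    {s : ℝ} (hs : 0 < s) (hs1 : s ≤ 1) (z : (Fin d → ℝ) × (Fin d → ℝ)) :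
    (∫⁻ w, F w * dec M (z - w)) ^ s ≤
      C ^ (1 - s) * ∫⁻ w, (F w * dec M (z - w)) ^ s := by
  set H := ∫⁻ w, F w * dec M (z - w) with hH
  have hHfin : H ≠ ∞ := by
    refine ((lintegral_mono fun w => ?_).trans_lt hfin.lt_top).ne
    refine mul_le_of_le_one_right zero_le ?_
    unfold dec
    rw [ENNReal.ofReal_le_one]
    exact Real.rpow_le_one_of_one_le_of_nonpos (by linarith [norm_nonneg (z - w)]) (by linarith)
  have hptw : ∀ u, F u * dec M (z - u) ≤ C * H := by
    intro u
    calc F u * dec M (z - u) ≤ (C * ∫⁻ w, F w * dec M (u - w)) * dec M (z - u) := by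
          gcongr; exact hrep u
      _ = C * ∫⁻ w, F w * dec M (u - w) * dec M (z - u) := by
          rw [lintegral_mul_const' _ _ (dec_ne_top _ _), mul_assoc]
      _ ≤ C * H := by
          refine mul_le_mul_right (lintegral_mono fun w => ?_) C
          rw [mul_assoc]
          refine mul_le_mul_right ?_ _
          simpa [add_comm] using dec_mul_dec_le hM (u - w) (z - u)
  rcases eq_or_ne H 0 with h0 | h0
  · rw [h0, ENNReal.zero_rpow_of_pos hs]
    exact zero_le
  have h1 : H ≤ (C * H) ^ (1 - s) * ∫⁻ w, (F w * dec M (z - w)) ^ s := by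
    rw [← lintegral_const_mul' _ _ (ENNReal.rpow_ne_top_of_nonneg (by linarith)
      (ENNReal.mul_ne_top hC hHfin))]
    refine lintegral_mono fun w => ?_
    calc F w * dec M (z - w)
        = (F w * dec M (z - w)) ^ (1 - s) * (F w * dec M (z - w)) ^ s := by
          rw [← ENNReal.rpow_add_of_nonneg _ _ (by linarith) hs.le]
          simp
      _ ≤ _ := by
          exact mul_le_mul_left (ENNReal.rpow_le_rpow (hptw w) (by linarith)) _
  have hne : H ^ (1 - s) ≠ 0 := by simp [h0, hHfin]
  have hnt : H ^ (1 - s) ≠ ∞ := ENNReal.rpow_ne_top_of_nonneg (by linarith) hHfin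
  rw [ENNReal.mul_rpow_of_nonneg _ _ (by linarith : 0 ≤ 1 - s)] at h1
  have e : H = H ^ s * H ^ (1 - s) := by
    rw [← ENNReal.rpow_add _ _ h0 hHfin]; simp
  refine (ENNReal.mul_le_mul_iff_left hne hnt).1 ?_
  rw [← e]
  exact h1.trans_eq (by ring)

theorem lintegral_prod_dec_eq (a : (Fin d → ℝ) → (Fin d → ℝ) → ℝ≥0∞) (N : ℝ)
    (ha : Measurable (Function.uncurry a)) (x ω : Fin d → ℝ) :
    ∫⁻ w : (Fin d → ℝ) × (Fin d → ℝ), a w.1 w.2 * (dec N (x - w.1) * dec N (ω - w.2)) =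
      ∫⁻ η, dec N η * ∫⁻ h, dec N h * a (x - h) (ω - η) := by
  have hm : Measurable fun w : (Fin d → ℝ) × (Fin d → ℝ) =>
      a w.1 w.2 * (dec N (x - w.1) * dec N (ω - w.2)) := by
    exact ha.mul (((measurable_dec N).comp (measurable_const.sub measurable_fst)).mul
      ((measurable_dec N).comp (measurable_const.sub measurable_snd)))
  rw [Measure.volume_eq_prod, lintegral_prod_symm' _ hm]
  rw [← lintegral_sub_left_eq_self _ ω]
  refine lintegral_congr fun η => ?_
  rw [← lintegral_const_mul' _ _ (dec_ne_top _ _)]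
  rw [← lintegral_sub_left_eq_self _ x]
  refine lintegral_congr fun h => ?_
  simp only [sub_sub_cancel]
  ring

/-- Mixed-norm bounds from pointwise kernel bounds, for all exponents `0 < p, q ≤ ∞`. -/
theorem mixedModNorm_le_of_kernel (m r : ℝ) {p q : ℝ≥0∞} (hp : p ≠ 0) (hq : q ≠ 0) :
    ∃ M : ℝ, ∀ C₁ C₂ : ℝ≥0∞, C₁ ≠ ∞ → C₂ ≠ ∞ → ∃ C : ℝ≥0∞, C ≠ ∞ ∧
      ∀ V U : (Fin d → ℝ) → (Fin d → ℝ) → ℂ, Continuous (Function.uncurry V) →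
        ∫⁻ w, ‖Function.uncurry V w‖ₑ ≠ ∞ →
        (∀ z, ‖Function.uncurry V z‖ₑ ≤
          C₁ * ∫⁻ w, ‖Function.uncurry V w‖ₑ * dec M (z - w)) →
        (∀ z, ‖Function.uncurry U z‖ₑ ≤
          C₂ * ENNReal.ofReal (jb2 z ^ m) * ∫⁻ w, ‖Function.uncurry V w‖ₑ * dec M (z - w)) →
        mixedModNorm p q r U ≤ C * mixedModNorm p q (r + m) V := by
  have hmin0 : min 1 (min p q) ≠ 0 := by simp [min_eq_iff, hp, hq]
  have hmint : min 1 (min p q) ≠ ∞ := ((min_le_left _ _).trans_lt ENNReal.one_lt_top).ne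
  set s : ℝ := (min 1 (min p q)).toReal with hsdef
  have hs : 0 < s := ENNReal.toReal_pos hmin0 hmint
  have hsof : ENNReal.ofReal s = min 1 (min p q) := ENNReal.ofReal_toReal hmint
  have hs1 : s ≤ 1 := by
    rw [← ENNReal.toReal_one]
    exact ENNReal.toReal_mono ENNReal.one_ne_top (min_le_left _ _)
  have hsof0 : ENNReal.ofReal s ≠ 0 := by rw [hsof]; exact hmin0
  have hP : 1 ≤ p / ENNReal.ofReal s := by
    rw [ENNReal.le_div_iff_mul_le (Or.inl hsof0) (Or.inl ENNReal.ofReal_ne_top), one_mul, hsof]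
    exact (min_le_right _ _).trans (min_le_left _ _)
  have hQ : 1 ≤ q / ENNReal.ofReal s := by
    rw [ENNReal.le_div_iff_mul_le (Or.inl hsof0) (Or.inl ENNReal.ofReal_ne_top), one_mul, hsof]
    exact (min_le_right _ _).trans (min_le_right _ _)
  set ρ := r + m with hρ
  set D : ℝ := d + 1 with hD
  have hD0 : 0 ≤ D := by positivity
  set M : ℝ := (D + D) / s + |ρ| with hM
  have hM0 : 0 ≤ M := by positivity
  refine ⟨M, fun C₁ C₂ hC₁ hC₂ => ?_⟩
  set κ : ℝ≥0∞ := ENNReal.ofReal ((2 * (1 + 2 * d)) ^ |ρ|) with hκ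
  set K : ℝ≥0∞ := ∫⁻ x : Fin d → ℝ, dec D x with hK
  have hKt : K ≠ ∞ := lintegral_dec_ne_top (by rw [hD]; linarith)
  set C' : ℝ≥0∞ := C₂ ^ s * C₁ ^ (1 - s) * κ ^ s with hC'
  have hC't : C' ≠ ∞ := by
    refine ENNReal.mul_ne_top (ENNReal.mul_ne_top ?_ ?_) ?_ <;>
      refine ENNReal.rpow_ne_top_of_nonneg (by linarith) ?_
    exacts [hC₂, hC₁, ENNReal.ofReal_ne_top]
  refine ⟨(C' * (K * K)) ^ (1 / s), ENNReal.rpow_ne_top_of_nonneg (by positivity)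
    (ENNReal.mul_ne_top hC't (ENNReal.mul_ne_top hKt hKt)), ?_⟩
  intro V U hV hfin h1 h2
  set a : (Fin d → ℝ) → (Fin d → ℝ) → ℝ≥0∞ := fun x ω =>
    ((‖V x ω‖₊ : ℝ≥0∞) * ENNReal.ofReal (jb2 (x, ω) ^ ρ)) ^ s with ha
  have hac : Continuous (Function.uncurry a) := by
    refine ENNReal.continuous_rpow_const.comp ?_
    have e1 : Continuous fun z : (Fin d → ℝ) × (Fin d → ℝ) => ENNReal.ofReal (jb2 z ^ ρ) :=
      ENNReal.continuous_ofReal.comp (continuous_jb2.rpow_const fun z => Or.inl (jb2_pos z).ne')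
    have e2 : Continuous fun z : (Fin d → ℝ) × (Fin d → ℝ) => ‖Function.uncurry V z‖ₑ :=
      hV.enorm
    exact e2.ennreal_mul e1 (fun z => Or.inr ENNReal.ofReal_ne_top) (fun z => Or.inr enorm_ne_top)
  have hptw : ∀ x ω, ((‖U x ω‖₊ : ℝ≥0∞) * ENNReal.ofReal (jb2 (x, ω) ^ r)) ^ s ≤
      C' * ∫⁻ η, dec D η * ∫⁻ h, dec D h * a (x - h) (ω - η) := by
    intro x ω
    set z := (x, ω) with hz
    have hjz := jb2_pos z
    set J : (Fin d → ℝ) × (Fin d → ℝ) → ℝ≥0∞ := fun z => ENNReal.ofReal (jb2 z ^ ρ) with hJ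
    calc ((‖U x ω‖₊ : ℝ≥0∞) * ENNReal.ofReal (jb2 z ^ r)) ^ s
        ≤ (C₂ * ENNReal.ofReal (jb2 z ^ m) * (∫⁻ w, ‖Function.uncurry V w‖ₑ * dec M (z - w)) *
            ENNReal.ofReal (jb2 z ^ r)) ^ s := by
          gcongr
          exact h2 z
      _ = C₂ ^ s * (J z ^ s * (∫⁻ w, ‖Function.uncurry V w‖ₑ * dec M (z - w)) ^ s) := by
          rw [← ENNReal.mul_rpow_of_nonneg _ _ hs.le, ← ENNReal.mul_rpow_of_nonneg _ _ hs.le]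
          congr 1
          have : J z = ENNReal.ofReal (jb2 z ^ m) * ENNReal.ofReal (jb2 z ^ r) := by
            rw [← ENNReal.ofReal_mul (by positivity), ← Real.rpow_add hjz, add_comm]
          rw [this]
          ring
      _ ≤ C₂ ^ s * (J z ^ s * (C₁ ^ (1 - s) *
            ∫⁻ w, (‖Function.uncurry V w‖ₑ * dec M (z - w)) ^ s)) := by
          gcongr
          exact rpow_lintegral_dec_le hM0 hC₁ hfin h1 hs hs1 z
      _ = C₂ ^ s * C₁ ^ (1 - s) *
            ∫⁻ w, (J z * dec M (z - w) * ‖Function.uncurry V w‖ₑ) ^ s := by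
          have : ∀ w, (J z * dec M (z - w) * ‖Function.uncurry V w‖ₑ) ^ s =
              J z ^ s * (‖Function.uncurry V w‖ₑ * dec M (z - w)) ^ s := by
            intro w
            rw [← ENNReal.mul_rpow_of_nonneg _ _ hs.le]
            congr 1; ring
          simp_rw [this]
          rw [lintegral_const_mul' _ _ (ENNReal.rpow_ne_top_of_nonneg hs.le ENNReal.ofReal_ne_top)]
          ring
      _ ≤ C₂ ^ s * C₁ ^ (1 - s) *
            ∫⁻ w : (Fin d → ℝ) × (Fin d → ℝ), κ ^ s * (a w.1 w.2 * (dec D (x - w.1) * dec D (ω - w.2))) := by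
          gcongr with w
          have hP1 : J z * dec M (z - w) ≤ κ * (J w * dec ((D + D) / s) (z - w)) := by
            have : dec M (z - w) * ENNReal.ofReal ((1 + ‖z - w‖) ^ |ρ|) =
                dec ((D + D) / s) (z - w) := by
              rw [hM, dec_add, mul_assoc]
              unfold dec
              rw [← ENNReal.ofReal_mul (p := (1 + ‖z - w‖) ^ (-|ρ|)) (by positivity),
                ← Real.rpow_add (by positivity)]
              simp
            rw [← this]
            calc J z * dec M (z - w) ≤ ENNReal.ofReal ((2 * (1 + 2 * d)) ^ |ρ| *
                  (jb2 w ^ ρ * (1 + ‖z - w‖) ^ |ρ|)) * dec M (z - w) := by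
                  gcongr
                  exact ENNReal.ofReal_le_ofReal (jb2_rpow_le ρ z w)
              _ = _ := by
                  have hjw := jb2_pos w
                  rw [ENNReal.ofReal_mul (by positivity), ENNReal.ofReal_mul (by positivity)]
                  ring
          calc (J z * dec M (z - w) * ‖Function.uncurry V w‖ₑ) ^ s
              ≤ (κ * (J w * dec ((D + D) / s) (z - w)) * ‖Function.uncurry V w‖ₑ) ^ s := by
                gcongr
            _ = κ ^ s * (a w.1 w.2 * dec (D + D) (z - w)) := by
                have e3 : dec (D + D) (z - w) = dec ((D + D) / s) (z - w) ^ s := by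
                  rw [dec_rpow _ hs.le, div_mul_cancel₀ _ hs.ne']
                have e4 : a w.1 w.2 = (‖Function.uncurry V w‖ₑ * J w) ^ s := rfl
                rw [e3, e4, ← ENNReal.mul_rpow_of_nonneg _ _ hs.le,
                  ← ENNReal.mul_rpow_of_nonneg _ _ hs.le]
                congr 1; ring
            _ ≤ _ := by
                gcongr
                exact dec_prod_le hD0 (x - w.1) (ω - w.2)
      _ = _ := by
          rw [lintegral_const_mul' _ _ (ENNReal.rpow_ne_top_of_nonneg hs.le ENNReal.ofReal_ne_top),
            lintegral_prod_dec_eq a D hac.measurable x ω, hC']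
          ring
  have hP0 : p / ENNReal.ofReal s ≠ 0 := (zero_lt_one.trans_le hP).ne'
  have hQ0 : q / ENNReal.ofReal s ≠ 0 := (zero_lt_one.trans_le hQ).ne'
  rw [← ENNReal.rpow_le_rpow_iff hs, ENNReal.mul_rpow_of_nonneg _ _ hs.le, ← ENNReal.rpow_mul,
    one_div_mul_cancel hs.ne', ENNReal.rpow_one, mixedModNorm_eq_lpn, mixedModNorm_eq_lpn,
    lpn_rpow hq hs, lpn_rpow hq hs]
  simp_rw [lpn_rpow hp hs]
  calc _ ≤ lpn (q / ENNReal.ofReal s) fun ω => lpn (p / ENNReal.ofReal s) fun x =>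
        C' * ∫⁻ η, dec D η * ∫⁻ h, dec D h * a (x - h) (ω - η) :=
        lpn_mono _ fun ω => lpn_mono _ fun x => hptw x ω
    _ = C' * lpn (q / ENNReal.ofReal s) fun ω => lpn (p / ENNReal.ofReal s) fun x =>
        ∫⁻ η, dec D η * ∫⁻ h, dec D h * a (x - h) (ω - η) := by
        simp_rw [lpn_const_mul hP0 hC't]
        rw [lpn_const_mul hQ0 hC't]
    _ ≤ C' * ((K * K) * lpn (q / ENNReal.ofReal s) fun ω => lpn (p / ENNReal.ofReal s) fun x =>
        a x ω) := by
        gcongr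
        exact lpn_lpn_conv_le hP hQ (measurable_dec D) (dec_ne_top D) hKt hac
    _ = _ := by rw [← mul_assoc]

/-! ### The character `s ↦ e^{2πis}` -/

/-- The character `s ↦ e^{2πis}`. -/
def ph (s : ℝ) : ℂ := Complex.exp (2 * π * Complex.I * s)

theorem ph_add (s t : ℝ) : ph (s + t) = ph s * ph t := by
  simp only [ph, ← Complex.exp_add]; push_cast; ring_nf

theorem norm_ph (s : ℝ) : ‖ph s‖ = 1 := by
  rw [ph, show (2 * π * Complex.I * s : ℂ) = ((2 * π * s : ℝ) : ℂ) * Complex.I by push_cast; ring]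
  exact Complex.norm_exp_ofReal_mul_I _

theorem conj_ph (s : ℝ) : (starRingEnd ℂ) (ph s) = ph (-s) := by
  simp only [ph, ← Complex.exp_conj]
  simp [map_ofNat]

theorem continuous_ph : Continuous ph := by unfold ph; fun_prop

theorem hasDerivAt_ph (s : ℝ) : HasDerivAt ph (2 * π * Complex.I * ph s) s := by
  have h := ((Complex.ofRealCLM.hasDerivAt (x := s)).const_mul (2 * π * Complex.I)).cexp
  refine HasDerivAt.congr_deriv (f := ph) h ?_
  simp [ph, mul_comm]

theorem ph_eq_fourierChar (s : ℝ) : ph s = Real.fourierChar s := by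
  rw [Real.fourierChar_apply, ph]; congr 1; push_cast; ring

theorem tshift_eq (w : (Fin d → ℝ) × (Fin d → ℝ)) (g : (Fin d → ℝ) → ℂ) (t : Fin d → ℝ) :
    tshift w g t = ph (w.2 ⬝ᵥ t) * g (t - w.1) := by
  simp [tshift, ph, dotProduct]

theorem wig_eq (τ : ℝ) (f h : (Fin d → ℝ) → ℂ) (p : (Fin d → ℝ) × (Fin d → ℝ)) :
    wig τ f h p = ∫ y : Fin d → ℝ, ph (-(y ⬝ᵥ p.2)) * f (p.1 + τ • y) *
      (starRingEnd ℂ) (h (p.1 - (1 - τ) • y)) := by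
  simp [wig, ph, dotProduct]

theorem stft_eq (g f : (Fin d → ℝ) → ℂ) (x ω : Fin d → ℝ) :
    stft g f x ω = ∫ y : Fin d → ℝ, ph (-(ω ⬝ᵥ y)) * f y * (starRingEnd ℂ) (g (y - x)) := by
  simp [stft, ph, dotProduct]

@[fun_prop]
theorem Continuous.dotProduct_real {Y : Type*} [TopologicalSpace Y] {a b : Y → Fin d → ℝ}
    (ha : Continuous a) (hb : Continuous b) : Continuous fun y => a y ⬝ᵥ b y := by
  unfold dotProduct; fun_prop

@[fun_prop]
theorem Continuous.ph_comp {Y : Type*} [TopologicalSpace Y] {a : Y → ℝ}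
    (ha : Continuous a) : Continuous fun y => ph (a y) := continuous_ph.comp ha

/-! ### Schwartz functions on products -/

/-- Pointwise decay of a bounded family of Schwartz functions. -/
theorem exists_decay_of_isVonNBounded {X : Type*} [NormedAddCommGroup X] [NormedSpace ℝ X]
    {B : Set 𝓢(X, ℂ)} (hB : Bornology.IsVonNBounded ℝ B) (K : ℕ) :
    ∃ C : ℝ, 0 ≤ C ∧ ∀ Φ ∈ B, ∀ x, (1 + ‖x‖) ^ K * ‖Φ x‖ ≤ C := by
  rw [(schwartz_withSeminorms ℝ X ℂ).isVonNBounded_iff_finset_seminorm_bounded] at hB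
  obtain ⟨r, hr, h⟩ := hB (Finset.Iic (K, 0))
  refine ⟨2 ^ K * r, by positivity, fun Φ hΦ x => ?_⟩
  have := SchwartzMap.one_add_le_sup_seminorm_apply (𝕜 := ℝ) (m := (K, 0)) (k := K) (n := 0)
    le_rfl le_rfl Φ x
  rw [norm_iteratedFDeriv_zero] at this
  refine this.trans ?_
  gcongr
  exact (h Φ hΦ).le

theorem pairMul_bound {X E : Type*} [NormedAddCommGroup X] [NormedSpace ℝ X]
    [NormedAddCommGroup E] [NormedSpace ℝ E] (g h : 𝓢(E, ℂ)) (A B : X →L[ℝ] E) {K : ℝ}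
    (hA : ‖A‖ ≤ K) (hB : ‖B‖ ≤ K) (hK : ∀ x, ‖x‖ ≤ K * max ‖A x‖ ‖B x‖) (k n : ℕ) (x : X) :
    ‖x‖ ^ k * ‖iteratedFDeriv ℝ n (fun x => g (A x) * h (B x)) x‖ ≤
      K ^ k * K ^ n * ∑ i ∈ Finset.range (n + 1), (n.choose i : ℝ) *
        (SchwartzMap.seminorm ℝ k i g * SchwartzMap.seminorm ℝ 0 (n - i) h +
          SchwartzMap.seminorm ℝ 0 i g * SchwartzMap.seminorm ℝ k (n - i) h) := by
  have hK0 : 0 ≤ K := (norm_nonneg _).trans hA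
  have hg : ContDiff ℝ n g := g.smooth n
  have hh : ContDiff ℝ n h := h.smooth n
  have key := norm_iteratedFDeriv_mul_le (𝕜 := ℝ) (N := n) (n := n)
    (hg.comp A.contDiff) (hh.comp B.contDiff) x le_rfl
  refine (mul_le_mul_of_nonneg_left key (by positivity)).trans ?_
  rw [Finset.mul_sum, Finset.mul_sum]
  refine Finset.sum_le_sum fun i hi => ?_
  have hi' : i ≤ n := Nat.lt_succ_iff.mp (Finset.mem_range.mp hi)
  have e1 : ‖iteratedFDeriv ℝ i (g ∘ A) x‖ ≤ ‖iteratedFDeriv ℝ i g (A x)‖ * K ^ i := by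
    rw [A.iteratedFDeriv_comp_right hg x (by exact_mod_cast hi')]
    refine (ContinuousMultilinearMap.norm_compContinuousLinearMap_le _ _).trans ?_
    simp only [Finset.prod_const, Finset.card_univ, Fintype.card_fin]
    gcongr
  have e2 : ‖iteratedFDeriv ℝ (n - i) (h ∘ B) x‖ ≤
      ‖iteratedFDeriv ℝ (n - i) h (B x)‖ * K ^ (n - i) := by
    rw [B.iteratedFDeriv_comp_right hh x (by exact_mod_cast Nat.sub_le n i)]
    refine (ContinuousMultilinearMap.norm_compContinuousLinearMap_le _ _).trans ?_
    simp only [Finset.prod_const, Finset.card_univ, Fintype.card_fin]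
    gcongr
  have e3 : ‖x‖ ^ k ≤ K ^ k * (‖A x‖ ^ k + ‖B x‖ ^ k) := by
    refine (pow_le_pow_left₀ (norm_nonneg _) (hK x) k).trans ?_
    rw [mul_pow]
    gcongr
    rcases max_choice ‖A x‖ ‖B x‖ with h | h <;> rw [h]
    · exact le_add_of_nonneg_right (by positivity)
    · exact le_add_of_nonneg_left (by positivity)
  have g1 := SchwartzMap.le_seminorm ℝ k i g (A x)
  have g2 := SchwartzMap.le_seminorm ℝ 0 i g (A x)
  have h1 := SchwartzMap.le_seminorm ℝ k (n - i) h (B x)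
  have h2 := SchwartzMap.le_seminorm ℝ 0 (n - i) h (B x)
  rw [pow_zero, one_mul] at g2 h2
  have eK : K ^ n = K ^ i * K ^ (n - i) := by rw [← pow_add, Nat.add_sub_cancel' hi']
  set a := ‖iteratedFDeriv ℝ i g (A x)‖
  set b := ‖iteratedFDeriv ℝ (n - i) h (B x)‖
  have ha : 0 ≤ a := norm_nonneg _
  have hb : 0 ≤ b := norm_nonneg _
  calc ‖x‖ ^ k * ((n.choose i : ℝ) * ‖iteratedFDeriv ℝ i (g ∘ A) x‖ *
        ‖iteratedFDeriv ℝ (n - i) (h ∘ B) x‖)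
      ≤ (K ^ k * (‖A x‖ ^ k + ‖B x‖ ^ k)) * ((n.choose i : ℝ) * (a * K ^ i) *
        (b * K ^ (n - i))) := by gcongr
    _ = K ^ k * K ^ n * ((n.choose i : ℝ) * ((‖A x‖ ^ k * a) * b + a * (‖B x‖ ^ k * b))) := by
        rw [eK]; ring
    _ ≤ _ := by
        gcongr

/-- The Schwartz function `x ↦ g (A x) * h (B x)`. -/
def pairMul {X E : Type*} [NormedAddCommGroup X] [NormedSpace ℝ X]
    [NormedAddCommGroup E] [NormedSpace ℝ E] (g h : 𝓢(E, ℂ)) (A B : X →L[ℝ] E) {K : ℝ}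
    (hA : ‖A‖ ≤ K) (hB : ‖B‖ ≤ K) (hK : ∀ x, ‖x‖ ≤ K * max ‖A x‖ ‖B x‖) : 𝓢(X, ℂ) where
  toFun x := g (A x) * h (B x)
  smooth' := ((g.smooth ⊤).comp A.contDiff).mul ((h.smooth ⊤).comp B.contDiff)
  decay' k n := ⟨_, pairMul_bound g h A B hA hB hK k n⟩

/-- Complex conjugation of a Schwartz function. -/
def conjS {E : Type*} [NormedAddCommGroup E] [NormedSpace ℝ E] (g : 𝓢(E, ℂ)) : 𝓢(E, ℂ) :=
  SchwartzMap.postcompCLM (𝕜 := ℝ) (Complex.conjCLE : ℂ →L[ℝ] ℂ) g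

theorem conjS_apply {E : Type*} [NormedAddCommGroup E] [NormedSpace ℝ E] (g : 𝓢(E, ℂ)) (x : E) :
    conjS g x = (starRingEnd ℂ) (g x) := by
  simp [conjS]

/-- The Schwartz function `(x, y) ↦ f(y) conj g(y - x)`. -/
def stftPair (g f : 𝓢(Fin d → ℝ, ℂ)) : 𝓢((Fin d → ℝ) × (Fin d → ℝ), ℂ) :=
  pairMul f (conjS g) (ContinuousLinearMap.snd ℝ _ _)
    (ContinuousLinearMap.snd ℝ _ _ - ContinuousLinearMap.fst ℝ _ _) (K := 3)
    (by exact (ContinuousLinearMap.norm_snd_le ..).trans (by norm_num))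
    (by
      refine (norm_sub_le _ _).trans ?_
      refine (add_le_add (ContinuousLinearMap.norm_snd_le ..)
        (ContinuousLinearMap.norm_fst_le ..)).trans (by norm_num))
    (by
      rintro ⟨x, y⟩
      have h1 : ‖x‖ ≤ ‖y‖ + ‖y - x‖ := by
        calc ‖x‖ = ‖y - (y - x)‖ := by congr 1; abel
          _ ≤ _ := norm_sub_le _ _
      simp only [Prod.norm_mk, sub_apply, ContinuousLinearMap.coe_snd',
        ContinuousLinearMap.coe_fst']
      have := norm_nonneg y
      have := le_max_left ‖y‖ ‖y - x‖
      have := le_max_right ‖y‖ ‖y - x‖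
      exact max_le (by linarith) (by linarith))

theorem stftPair_apply (g f : 𝓢(Fin d → ℝ, ℂ)) (p : (Fin d → ℝ) × (Fin d → ℝ)) :
    stftPair g f p = f p.2 * (starRingEnd ℂ) (g (p.2 - p.1)) := by
  change f _ * conjS g _ = _
  rw [conjS_apply]; rfl

theorem norm_fst_add_smul_snd_le {s : ℝ} (hs : |s| ≤ 1) :
    ‖ContinuousLinearMap.fst ℝ (Fin d → ℝ) (Fin d → ℝ) +
      s • ContinuousLinearMap.snd ℝ (Fin d → ℝ) (Fin d → ℝ)‖ ≤ 3 := by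
  refine (norm_add_le _ _).trans ?_
  rw [norm_smul, Real.norm_eq_abs]
  have h1 := ContinuousLinearMap.norm_fst_le ℝ (Fin d → ℝ) (Fin d → ℝ)
  have h2 := ContinuousLinearMap.norm_snd_le ℝ (Fin d → ℝ) (Fin d → ℝ)
  have := mul_le_mul hs h2 (norm_nonneg _) zero_le_one
  linarith

theorem norm_le_tau_pair {τ : ℝ} (hτ : τ ∈ Set.Icc (0 : ℝ) 1) (p : (Fin d → ℝ) × (Fin d → ℝ)) :
    ‖p‖ ≤ 3 * max ‖p.1 + τ • p.2‖ ‖p.1 + (-(1 - τ)) • p.2‖ := by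
  obtain ⟨h0, h1⟩ := hτ
  set a := p.1 + τ • p.2 with ha
  set b := p.1 + (-(1 - τ)) • p.2 with hb
  have e2 : p.2 = a - b := by rw [ha, hb]; module
  have e1 : p.1 = (1 - τ) • a + τ • b := by rw [ha, hb]; module
  have l1 := le_max_left ‖a‖ ‖b‖
  have l2 := le_max_right ‖a‖ ‖b‖
  have hn := norm_nonneg a
  rw [Prod.norm_def]
  refine max_le ?_ ?_
  · rw [e1]
    refine (norm_add_le _ _).trans ?_
    rw [norm_smul, norm_smul, Real.norm_of_nonneg h0, Real.norm_of_nonneg (by linarith)]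
    nlinarith [norm_nonneg b]
  · rw [e2]
    refine (norm_sub_le _ _).trans ?_
    linarith

/-- The Schwartz function `(x, y) ↦ conj g(x + τy) g(x - (1-τ)y)`. -/
def tauPair (g : 𝓢(Fin d → ℝ, ℂ)) {τ : ℝ} (hτ : τ ∈ Set.Icc (0 : ℝ) 1) :
    𝓢((Fin d → ℝ) × (Fin d → ℝ), ℂ) :=
  pairMul (conjS g) g
    (ContinuousLinearMap.fst ℝ _ _ + τ • ContinuousLinearMap.snd ℝ _ _)
    (ContinuousLinearMap.fst ℝ _ _ + (-(1 - τ)) • ContinuousLinearMap.snd ℝ _ _) (K := 3)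
    (norm_fst_add_smul_snd_le (abs_le.2 ⟨by linarith [hτ.1], hτ.2⟩))
    (norm_fst_add_smul_snd_le (abs_le.2 ⟨by linarith [hτ.1], by linarith [hτ.2]⟩))
    (norm_le_tau_pair hτ)

theorem tauPair_apply (g : 𝓢(Fin d → ℝ, ℂ)) {τ : ℝ} (hτ : τ ∈ Set.Icc (0 : ℝ) 1)
    (p : (Fin d → ℝ) × (Fin d → ℝ)) :
    tauPair g hτ p =
      (starRingEnd ℂ) (g (p.1 + τ • p.2)) * g (p.1 + (-(1 - τ)) • p.2) := by
  change conjS g _ * g _ = _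
  rw [conjS_apply]; rfl

theorem isVonNBounded_tauPair (g : 𝓢(Fin d → ℝ, ℂ)) :
    Bornology.IsVonNBounded ℝ
      (Set.range fun τ : Set.Icc (0 : ℝ) 1 => tauPair g τ.2) := by
  rw [← Set.image_univ,
    (schwartz_withSeminorms ℝ _ ℂ).image_isVonNBounded_iff_seminorm_bounded]
  rintro ⟨k, n⟩
  set M : ℝ := 3 ^ k * 3 ^ n * ∑ i ∈ Finset.range (n + 1), (n.choose i : ℝ) *
        (SchwartzMap.seminorm ℝ k i (conjS g) * SchwartzMap.seminorm ℝ 0 (n - i) g +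
          SchwartzMap.seminorm ℝ 0 i (conjS g) * SchwartzMap.seminorm ℝ k (n - i) g) with hM
  have hM0 : 0 ≤ M := by positivity
  refine ⟨M + 1, by linarith, fun τ _ => ?_⟩
  refine lt_of_le_of_lt ?_ (lt_add_one M)
  exact SchwartzMap.seminorm_le_bound ℝ k n _ hM0 fun x =>
    pairMul_bound (conjS g) g _ _
      (norm_fst_add_smul_snd_le (abs_le.2 ⟨by linarith [τ.2.1], τ.2.2⟩))
      (norm_fst_add_smul_snd_le (abs_le.2 ⟨by linarith [τ.2.1], by linarith [τ.2.2]⟩))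
      (norm_le_tau_pair τ.2) k n x

/-! ### Partial Fourier transform of Schwartz functions -/

/-- An integrable weight on `ℝ^d`. -/
def bump (y : Fin d → ℝ) : ℝ := ((1 + ‖y‖) ^ (d + 1))⁻¹

theorem bump_nonneg (y : Fin d → ℝ) : 0 ≤ bump y := by unfold bump; positivity

theorem integrable_bump : Integrable (bump : (Fin d → ℝ) → ℝ) := by
  have h := integrable_one_add_norm (E := Fin d → ℝ) (μ := volume) (r := (d + 1 : ℕ)) (by simp)
  refine h.congr (Filter.Eventually.of_forall fun y => ?_)
  simp only [bump]
  rw [Real.rpow_neg (by positivity), Real.rpow_natCast]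

theorem one_add_norm_le_prod (p : (Fin d → ℝ) × (Fin d → ℝ)) :
    1 + ‖p‖ ≤ (1 + ‖p.1‖) * (1 + ‖p.2‖) := by
  have h1 := norm_nonneg p.1
  have h2 := norm_nonneg p.2
  have : ‖p‖ ≤ ‖p.1‖ + ‖p.2‖ := by
    rw [Prod.norm_def]; exact max_le (by linarith) (by linarith)
  nlinarith

theorem exists_slice_bound {B : Set 𝓢((Fin d → ℝ) × (Fin d → ℝ), ℂ)}
    (hB : Bornology.IsVonNBounded ℝ B) (K : ℕ) :
    ∃ C : ℝ, 0 ≤ C ∧ ∀ Φ ∈ B, ∀ x y, (1 + ‖x‖) ^ K * ‖Φ (x, y)‖ ≤ C * bump y := by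
  obtain ⟨C, hC, h⟩ := exists_decay_of_isVonNBounded hB (K + (d + 1))
  refine ⟨C, hC, fun Φ hΦ x y => ?_⟩
  have := h Φ hΦ (x, y)
  rw [bump, ← div_eq_mul_inv, le_div_iff₀ (by positivity)]
  refine le_trans ?_ this
  rw [pow_add _ K (d + 1)]
  have h1 : (1 + ‖x‖) ≤ 1 + ‖(x, y)‖ := by gcongr; exact norm_fst_le (x, y)
  have h2 : (1 + ‖y‖) ≤ 1 + ‖(x, y)‖ := by gcongr; exact norm_snd_le (x, y)
  calc (1 + ‖x‖) ^ K * ‖Φ (x, y)‖ * (1 + ‖y‖) ^ (d + 1)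
      = (1 + ‖x‖) ^ K * (1 + ‖y‖) ^ (d + 1) * ‖Φ (x, y)‖ := by ring
    _ ≤ _ := by gcongr

theorem exists_slice_bound_single (Φ : 𝓢((Fin d → ℝ) × (Fin d → ℝ), ℂ)) :
    ∃ C : ℝ, 0 ≤ C ∧ ∀ x y, ‖Φ (x, y)‖ ≤ C * bump y := by
  obtain ⟨C, hC, h⟩ := exists_slice_bound (Bornology.isVonNBounded_singleton (𝕜 := ℝ) Φ) 0
  exact ⟨C, hC, fun x y => by simpa using h Φ rfl x y⟩

theorem integrable_slice (Φ : 𝓢((Fin d → ℝ) × (Fin d → ℝ), ℂ)) (x : Fin d → ℝ) :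
    Integrable fun y => Φ (x, y) := by
  obtain ⟨C, hC, h⟩ := exists_slice_bound_single Φ
  exact (integrable_bump.const_mul C).mono'
    (Φ.continuous.comp (by fun_prop)).aestronglyMeasurable
    (Filter.Eventually.of_forall fun y => h x y)

/-- The partial Fourier transform in the second variable. -/
def pft (Φ : 𝓢((Fin d → ℝ) × (Fin d → ℝ), ℂ)) (p : (Fin d → ℝ) × (Fin d → ℝ)) : ℂ :=
  ∫ y, ph (y ⬝ᵥ p.2) * Φ (p.1, y)

theorem integrable_ph_mul {Y : Type*} [TopologicalSpace Y] [MeasurableSpace Y] [BorelSpace Y]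
    {μ : Measure Y}
    {φ : Y → ℂ} (hφ : Integrable φ μ) {a : Y → ℝ} (ha : Continuous a) :
    Integrable (fun y => ph (a y) * φ y) μ := by
  refine hφ.bdd_mul (c := 1) (ha.ph_comp.aestronglyMeasurable) ?_
  exact Filter.Eventually.of_forall fun y => (norm_ph _).le

theorem integrable_pft (Φ : 𝓢((Fin d → ℝ) × (Fin d → ℝ), ℂ)) (p : (Fin d → ℝ) × (Fin d → ℝ)) :
    Integrable fun y => ph (y ⬝ᵥ p.2) * Φ (p.1, y) :=
  integrable_ph_mul (integrable_slice Φ p.1) (by fun_prop)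

theorem continuous_pft (Φ : 𝓢((Fin d → ℝ) × (Fin d → ℝ), ℂ)) : Continuous (pft Φ) := by
  obtain ⟨C, hC, h⟩ := exists_slice_bound_single Φ
  refine continuous_of_dominated (bound := fun y => C * bump y) (fun p => ?_) (fun p => ?_)
    (integrable_bump.const_mul C) ?_
  · exact (integrable_pft Φ p).aestronglyMeasurable
  · refine Filter.Eventually.of_forall fun y => ?_
    rw [norm_mul, norm_ph, one_mul]; exact h _ _
  · refine Filter.Eventually.of_forall fun y => ?_
    have := Φ.continuous
    fun_prop

theorem exists_pft_bound_fst {B : Set 𝓢((Fin d → ℝ) × (Fin d → ℝ), ℂ)}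
    (hB : Bornology.IsVonNBounded ℝ B) (K : ℕ) :
    ∃ C : ℝ, 0 ≤ C ∧ ∀ Φ ∈ B, ∀ p, (1 + ‖p.1‖) ^ K * ‖pft Φ p‖ ≤ C := by
  obtain ⟨C, hC, h⟩ := exists_slice_bound hB K
  refine ⟨C * ∫ y : Fin d → ℝ, bump y, mul_nonneg hC (integral_nonneg bump_nonneg),
    fun Φ hΦ p => ?_⟩
  rw [← integral_const_mul]
  have : (1 + ‖p.1‖) ^ K * ‖pft Φ p‖ =
      ‖∫ y, (((1 + ‖p.1‖) ^ K : ℝ) : ℂ) * (ph (y ⬝ᵥ p.2) * Φ (p.1, y))‖ := by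
    rw [integral_const_mul, norm_mul, Complex.norm_real, Real.norm_of_nonneg (by positivity)]; rfl
  rw [this]
  refine norm_integral_le_of_norm_le (integrable_bump.const_mul C)
    (Filter.Eventually.of_forall fun y => ?_)
  rw [norm_mul, norm_mul, norm_ph, one_mul, Complex.norm_real, Real.norm_of_nonneg (by positivity)]
  exact h Φ hΦ _ _

/-- The real-linear functional `y ↦ y · v`. -/
def dotL (v : Fin d → ℝ) : (Fin d → ℝ) →L[ℝ] ℝ :=
  LinearMap.toContinuousLinearMap
    { toFun := fun y => y ⬝ᵥ v
      map_add' := fun a b => add_dotProduct a b v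
      map_smul' := fun c a => smul_dotProduct c a v }

theorem dotL_apply (v y : Fin d → ℝ) : dotL v y = y ⬝ᵥ v := rfl

theorem hasLineDerivAt_ph {X : Type*} [NormedAddCommGroup X] [NormedSpace ℝ X]
    (ℓ : X →L[ℝ] ℝ) (x v : X) :
    HasLineDerivAt ℝ (fun x => ph (ℓ x)) (2 * π * I * ℓ v * ph (ℓ x)) x v := by
  have h1 : HasDerivAt (fun t : ℝ => ℓ x + t * ℓ v) (ℓ v) 0 := by
    simpa using ((hasDerivAt_id (0 : ℝ)).mul_const (ℓ v)).const_add (ℓ x)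
  have h2 := (hasDerivAt_ph (ℓ x + 0 * ℓ v)).scomp (0 : ℝ) h1
  have h3 : (ph ∘ fun t : ℝ => ℓ x + t * ℓ v) = fun t : ℝ => ph (ℓ (x + t • v)) := by
    funext t; simp
  rw [h3] at h2
  refine HasDerivAt.congr_deriv h2 ?_
  simp; ring

theorem hasLineDerivAt_schwartz {X : Type*} [NormedAddCommGroup X] [NormedSpace ℝ X]
    (Φ : 𝓢(X, ℂ)) (x v : X) :
    HasLineDerivAt ℝ Φ (LineDeriv.lineDerivOpCLM ℝ 𝓢(X, ℂ) v Φ x) x v :=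
  (Φ.hasFDerivAt x).hasLineDerivAt v

theorem pft_lineDeriv_snd (Φ : 𝓢((Fin d → ℝ) × (Fin d → ℝ), ℂ)) (v : Fin d → ℝ)
    (p : (Fin d → ℝ) × (Fin d → ℝ)) :
    pft (LineDeriv.lineDerivOpCLM ℝ _ ((0 : Fin d → ℝ), v) Φ) p =
      -(2 * π * I * ((v ⬝ᵥ p.2 : ℝ) : ℂ) * pft Φ p) := by
  set Ψ := LineDeriv.lineDerivOpCLM ℝ 𝓢((Fin d → ℝ) × (Fin d → ℝ), ℂ)
    ((0 : Fin d → ℝ), v) Φ with hΨ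
  have key := integral_bilinear_hasLineDerivAt_right_eq_neg_left_of_integrable
    (μ := (volume : Measure (Fin d → ℝ))) (B := ContinuousLinearMap.mul ℝ ℂ) (v := v)
    (f := fun y => ph (dotL p.2 y)) (f' := fun y => 2 * π * I * dotL p.2 v * ph (dotL p.2 y))
    (g := fun y => Φ (p.1, y)) (g' := fun y => Ψ (p.1, y)) ?_ ?_ ?_ ?_ ?_
  · simp only [ContinuousLinearMap.mul_apply'] at key
    unfold pft
    refine key.trans ?_
    simp only [mul_assoc]
    simp only [integral_const_mul, dotL_apply]
  · simp only [ContinuousLinearMap.mul_apply', mul_assoc]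
    exact ((((integrable_pft Φ p).const_mul _).const_mul _).const_mul _).const_mul _
  · exact integrable_pft Ψ p
  · exact integrable_pft Φ p
  · exact fun y _ => hasLineDerivAt_ph (dotL p.2) y v
  · intro y _
    have := hasLineDerivAt_schwartz Φ (p.1, y) (0, v)
    simpa [HasLineDerivAt, hΨ] using this

theorem one_add_norm_pow_le (w : Fin d → ℝ) (N : ℕ) :
    (1 + ‖w‖) ^ N ≤ 2 ^ N * (1 + ∑ j, |w j| ^ N) := by
  have hs : 0 ≤ ∑ j, |w j| ^ N := Finset.sum_nonneg fun j _ => by positivity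
  rcases le_total ‖w‖ 1 with h | h
  · calc (1 + ‖w‖) ^ N ≤ 2 ^ N * 1 := by rw [mul_one]; gcongr; linarith
      _ ≤ _ := by gcongr; linarith
  · obtain ⟨j, hj⟩ : ∃ j, ‖w‖ = |w j| := by
      have hne : Nonempty (Fin d) := by
        by_contra hcon
        rw [not_nonempty_iff] at hcon
        have : ‖w‖ = 0 := by rw [Subsingleton.elim w 0, norm_zero]
        linarith
      obtain ⟨j, hj⟩ := Finite.exists_max fun j => ‖w j‖
      exact ⟨j, le_antisymm ((pi_norm_le_iff_of_nonneg (norm_nonneg _)).2 hj) (norm_le_pi_norm w j)⟩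
    calc (1 + ‖w‖) ^ N ≤ (2 * ‖w‖) ^ N := by gcongr; linarith
      _ = 2 ^ N * |w j| ^ N := by rw [mul_pow, hj]
      _ ≤ _ := by
        gcongr
        have := Finset.single_le_sum (f := fun j => |w j| ^ N) (fun j _ => by positivity)
          (Finset.mem_univ j)
        linarith

theorem exists_pft_bound_coord (j : Fin d) (K N : ℕ) :
    ∀ {B : Set 𝓢((Fin d → ℝ) × (Fin d → ℝ), ℂ)}, Bornology.IsVonNBounded ℝ B →
    ∃ C : ℝ, 0 ≤ C ∧ ∀ Φ ∈ B, ∀ p, |p.2 j| ^ N * ((1 + ‖p.1‖) ^ K * ‖pft Φ p‖) ≤ C := by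
  induction N with
  | zero => intro B hB; simpa using exists_pft_bound_fst hB K
  | succ N ih =>
    intro B hB
    obtain ⟨C, hC, h⟩ := ih (hB.image (LineDeriv.lineDerivOpCLM ℝ
      𝓢((Fin d → ℝ) × (Fin d → ℝ), ℂ) ((0 : Fin d → ℝ), (Pi.single j 1 : Fin d → ℝ))))
    refine ⟨C, hC, fun Φ hΦ p => ?_⟩
    have := h _ (Set.mem_image_of_mem _ hΦ) p
    rw [pft_lineDeriv_snd] at this
    refine le_trans ?_ this
    have e : (Pi.single j 1 : Fin d → ℝ) ⬝ᵥ p.2 = p.2 j := by simp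
    rw [e, norm_neg, norm_mul, norm_mul, norm_mul, norm_mul, Complex.norm_real, Complex.norm_real,
      Complex.norm_I, Real.norm_eq_abs, Real.norm_eq_abs, abs_of_pos Real.pi_pos, pow_succ]
    have h1 : 1 ≤ ‖(2 : ℂ)‖ * π * 1 := by
      have := Real.pi_gt_three
      norm_num; linarith
    calc |p.2 j| ^ N * |p.2 j| * ((1 + ‖p.1‖) ^ K * ‖pft Φ p‖)
        = 1 * (|p.2 j| ^ N * |p.2 j| * ((1 + ‖p.1‖) ^ K * ‖pft Φ p‖)) := (one_mul _).symm
      _ ≤ (‖(2 : ℂ)‖ * π * 1) * (|p.2 j| ^ N * |p.2 j| * ((1 + ‖p.1‖) ^ K * ‖pft Φ p‖)) := by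
        gcongr
      _ = _ := by ring

theorem exists_pft_bound {B : Set 𝓢((Fin d → ℝ) × (Fin d → ℝ), ℂ)}
    (hB : Bornology.IsVonNBounded ℝ B) (K : ℕ) :
    ∃ C : ℝ, 0 ≤ C ∧ ∀ Φ ∈ B, ∀ p, (1 + ‖p‖) ^ K * ‖pft Φ p‖ ≤ C := by
  obtain ⟨C₀, hC₀, h₀⟩ := exists_pft_bound_fst hB K
  choose C hC h using fun j : Fin d => exists_pft_bound_coord j K K hB
  have hs : 0 ≤ ∑ j, C j := Finset.sum_nonneg fun j _ => hC j
  refine ⟨2 ^ K * (C₀ + ∑ j, C j), by positivity, fun Φ hΦ p => ?_⟩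
  calc (1 + ‖p‖) ^ K * ‖pft Φ p‖
      ≤ ((1 + ‖p.1‖) * (1 + ‖p.2‖)) ^ K * ‖pft Φ p‖ := by
        gcongr; exact one_add_norm_le_prod p
    _ = (1 + ‖p.2‖) ^ K * ((1 + ‖p.1‖) ^ K * ‖pft Φ p‖) := by rw [mul_pow]; ring
    _ ≤ (2 ^ K * (1 + ∑ j, |p.2 j| ^ K)) * ((1 + ‖p.1‖) ^ K * ‖pft Φ p‖) := by
        gcongr; exact one_add_norm_pow_le _ _
    _ = 2 ^ K * ((1 + ‖p.1‖) ^ K * ‖pft Φ p‖ +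
        ∑ j, |p.2 j| ^ K * ((1 + ‖p.1‖) ^ K * ‖pft Φ p‖)) := by
        rw [← Finset.sum_mul]; ring
    _ ≤ _ := by
        gcongr with j
        · exact h₀ Φ hΦ p
        · exact h j Φ hΦ p

theorem exists_pft_bound_single (Φ : 𝓢((Fin d → ℝ) × (Fin d → ℝ), ℂ)) (K : ℕ) :
    ∃ C : ℝ, 0 ≤ C ∧ ∀ p, (1 + ‖p‖) ^ K * ‖pft Φ p‖ ≤ C := by
  obtain ⟨C, hC, h⟩ := exists_pft_bound (Bornology.isVonNBounded_singleton (𝕜 := ℝ) Φ) K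
  exact ⟨C, hC, fun p => h Φ rfl p⟩

/-- The operator on Schwartz functions intertwined by the partial Fourier transform with the
derivative in the direction `v`. -/
def pftDeriv (v : (Fin d → ℝ) × (Fin d → ℝ)) :
    𝓢((Fin d → ℝ) × (Fin d → ℝ), ℂ) →L[ℝ] 𝓢((Fin d → ℝ) × (Fin d → ℝ), ℂ) :=
  LineDeriv.lineDerivOpCLM ℝ _ (v.1, (0 : Fin d → ℝ)) +
    (2 * π * I : ℂ) • SchwartzMap.smulLeftCLM ℂ
      (dotL v.2 ∘L ContinuousLinearMap.snd ℝ (Fin d → ℝ) (Fin d → ℝ))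

theorem pftDeriv_apply (v : (Fin d → ℝ) × (Fin d → ℝ)) (Φ : 𝓢((Fin d → ℝ) × (Fin d → ℝ), ℂ))
    (p : (Fin d → ℝ) × (Fin d → ℝ)) :
    pftDeriv v Φ p = LineDeriv.lineDerivOpCLM ℝ 𝓢((Fin d → ℝ) × (Fin d → ℝ), ℂ)
      (v.1, (0 : Fin d → ℝ)) Φ p + 2 * π * I * ((p.2 ⬝ᵥ v.2 : ℝ) : ℂ) * Φ p := by
  have := SchwartzMap.smulLeftCLM_apply_apply
    (dotL v.2 ∘L ContinuousLinearMap.snd ℝ (Fin d → ℝ) (Fin d → ℝ)).hasTemperateGrowth Φ p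
  change _ + (2 * π * I) * (SchwartzMap.smulLeftCLM ℂ
      (dotL v.2 ∘L ContinuousLinearMap.snd ℝ (Fin d → ℝ) (Fin d → ℝ)) Φ p) = _
  rw [this]
  simp [dotL_apply, mul_assoc]

theorem hasLineDerivAt_pft (Φ : 𝓢((Fin d → ℝ) × (Fin d → ℝ), ℂ))
    (p v : (Fin d → ℝ) × (Fin d → ℝ)) :
    HasLineDerivAt ℝ (pft Φ) (pft (pftDeriv v Φ) p) p v := by
  obtain ⟨C, hC, h⟩ := exists_slice_bound_single (pftDeriv v Φ)
  have key := hasDerivAt_integral_of_dominated_loc_of_deriv_le (μ := (volume : Measure (Fin d → ℝ)))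
    (F := fun (t : ℝ) y => ph (y ⬝ᵥ (p + t • v).2) * Φ ((p + t • v).1, y))
    (F' := fun (t : ℝ) y => ph (y ⬝ᵥ (p + t • v).2) * pftDeriv v Φ ((p + t • v).1, y))
    (x₀ := (0 : ℝ)) (s := Set.univ) (bound := fun y => C * bump y) Filter.univ_mem
    (Filter.Eventually.of_forall fun t => (integrable_pft Φ (p + t • v)).aestronglyMeasurable)
    (integrable_pft Φ _) (integrable_pft (pftDeriv v Φ) _).aestronglyMeasurable
    (Filter.Eventually.of_forall fun y t _ => by
      rw [norm_mul, norm_ph, one_mul]; exact h _ _)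
    (integrable_bump.const_mul C)
    (Filter.Eventually.of_forall fun y t _ => ?_)
  · have h2 := key.2
    simp only [zero_smul, add_zero] at h2
    exact h2
  · have e1 : HasDerivAt (fun t : ℝ => ph (y ⬝ᵥ (p + t • v).2))
        (2 * π * I * ((y ⬝ᵥ v.2 : ℝ) : ℂ) * ph (y ⬝ᵥ (p + t • v).2)) t := by
      have h1 : HasDerivAt (fun t : ℝ => y ⬝ᵥ (p + t • v).2) (y ⬝ᵥ v.2) t := by
        have : (fun t : ℝ => y ⬝ᵥ (p + t • v).2) = fun t : ℝ => y ⬝ᵥ p.2 + t * (y ⬝ᵥ v.2) := by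
          funext t; simp [dotProduct_add, dotProduct_smul]
        rw [this]
        simpa using ((hasDerivAt_id t).mul_const (y ⬝ᵥ v.2)).const_add (y ⬝ᵥ p.2)
      have h2 := (hasDerivAt_ph (y ⬝ᵥ (p + t • v).2)).scomp t h1
      refine HasDerivAt.congr_deriv h2 ?_
      simp; ring
    have e2 : HasDerivAt (fun t : ℝ => Φ ((p + t • v).1, y))
        (LineDeriv.lineDerivOpCLM ℝ 𝓢((Fin d → ℝ) × (Fin d → ℝ), ℂ)
          (v.1, (0 : Fin d → ℝ)) Φ ((p + t • v).1, y)) t := by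
      have h1 : HasDerivAt (fun t : ℝ => ((p + t • v).1, y)) (v.1, (0 : Fin d → ℝ)) t := by
        refine HasDerivAt.prodMk ?_ (hasDerivAt_const _ _)
        have := ((hasDerivAt_id t).smul_const v.1).const_add p.1
        simpa using this
      exact (Φ.hasFDerivAt _).comp_hasDerivAt t h1
    refine HasDerivAt.congr_deriv (e1.mul e2) ?_
    rw [pftDeriv_apply]
    ring

/-! ### Decay of the Gabor matrix -/

instance isAddHaarMeasure_volume_phaseSpace :
    (volume : Measure ((Fin d → ℝ) × (Fin d → ℝ))).IsAddHaarMeasure :=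
  Measure.prod.instIsAddHaarMeasure volume volume

/-- An integrable weight on phase space. -/
def bump2 (p : (Fin d → ℝ) × (Fin d → ℝ)) : ℝ := ((1 + ‖p‖) ^ (2 * d + 1))⁻¹

theorem bump2_nonneg (p : (Fin d → ℝ) × (Fin d → ℝ)) : 0 ≤ bump2 p := by
  unfold bump2; positivity

theorem integrable_bump2 : Integrable (bump2 : (Fin d → ℝ) × (Fin d → ℝ) → ℝ) := by
  have h := integrable_one_add_norm (E := (Fin d → ℝ) × (Fin d → ℝ)) (μ := volume)
    (r := (2 * d + 1 : ℕ)) (by simp; linarith)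
  refine h.congr (Filter.Eventually.of_forall fun y => ?_)
  simp only [bump2]
  rw [Real.rpow_neg (by positivity), Real.rpow_natCast]

theorem exists_symbol_mul_pft_bound {m : ℝ} {σ : (Fin d → ℝ) × (Fin d → ℝ) → ℂ}
    {C₀ : ℝ} (hC₀ : ∀ z, ‖σ z‖ ≤ C₀ * jb2 z ^ m)
    {B : Set 𝓢((Fin d → ℝ) × (Fin d → ℝ), ℂ)} (hB : Bornology.IsVonNBounded ℝ B) :
    ∃ C : ℝ, 0 ≤ C ∧ ∀ Φ ∈ B, ∀ c p, ‖σ (p + c)‖ * ‖pft Φ p‖ ≤ C * jb2 c ^ m * bump2 p := by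
  have hC₀' : 0 ≤ C₀ := by
    have := (norm_nonneg _).trans (hC₀ 0)
    exact nonneg_of_mul_nonneg_left this (Real.rpow_pos_of_pos (jb2_pos _) _)
  obtain ⟨C₁, hC₁, h₁⟩ := exists_pft_bound hB (⌈|m|⌉₊ + (2 * d + 1))
  refine ⟨C₀ * (2 * (1 + 2 * d)) ^ |m| * C₁, by positivity, fun Φ hΦ c p => ?_⟩
  have hj : 0 < jb2 c ^ m := Real.rpow_pos_of_pos (jb2_pos _) _
  have e1 : ‖σ (p + c)‖ ≤ C₀ * ((2 * (1 + 2 * d)) ^ |m| * (jb2 c ^ m * (1 + ‖p‖) ^ ⌈|m|⌉₊)) := by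
    refine (hC₀ _).trans ?_
    gcongr
    refine (jb2_rpow_le m (p + c) c).trans ?_
    rw [add_sub_cancel_right, ← Real.rpow_natCast]
    gcongr
    · linarith [norm_nonneg p]
    · exact Nat.le_ceil _
  have e2 : (1 + ‖p‖) ^ ⌈|m|⌉₊ * ‖pft Φ p‖ ≤ C₁ * bump2 p := by
    rw [bump2, ← div_eq_mul_inv, le_div_iff₀ (by positivity)]
    refine le_trans (le_of_eq ?_) (h₁ Φ hΦ p)
    rw [pow_add _ ⌈|m|⌉₊ (2 * d + 1)]; ring
  calc ‖σ (p + c)‖ * ‖pft Φ p‖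
      ≤ C₀ * ((2 * (1 + 2 * d)) ^ |m| * (jb2 c ^ m * (1 + ‖p‖) ^ ⌈|m|⌉₊)) * ‖pft Φ p‖ := by
        gcongr
    _ = C₀ * (2 * (1 + 2 * d)) ^ |m| * jb2 c ^ m * ((1 + ‖p‖) ^ ⌈|m|⌉₊ * ‖pft Φ p‖) := by ring
    _ ≤ C₀ * (2 * (1 + 2 * d)) ^ |m| * jb2 c ^ m * (C₁ * bump2 p) := by gcongr
    _ = _ := by ring

theorem integrable_symbol_mul_pft {m : ℝ} {σ : (Fin d → ℝ) × (Fin d → ℝ) → ℂ}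
    (hσ : Continuous σ) {C₀ : ℝ} (hC₀ : ∀ z, ‖σ z‖ ≤ C₀ * jb2 z ^ m)
    (Φ : 𝓢((Fin d → ℝ) × (Fin d → ℝ), ℂ)) (c : (Fin d → ℝ) × (Fin d → ℝ)) :
    Integrable fun p => σ (p + c) * pft Φ p := by
  obtain ⟨C, hC, h⟩ := exists_symbol_mul_pft_bound hC₀
    (Bornology.isVonNBounded_singleton (𝕜 := ℝ) Φ)
  refine (integrable_bump2.const_mul (C * jb2 c ^ m)).mono' ?_
    (Filter.Eventually.of_forall fun p => ?_)
  · have := continuous_pft Φ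
    exact Continuous.aestronglyMeasurable (by fun_prop)
  · rw [norm_mul]; exact h Φ rfl c p

/-- The oscillatory integral governing the Gabor matrix. -/
def gab (σ : (Fin d → ℝ) × (Fin d → ℝ) → ℂ) (ℓ : (Fin d → ℝ) × (Fin d → ℝ) →L[ℝ] ℝ)
    (c : (Fin d → ℝ) × (Fin d → ℝ)) (Φ : 𝓢((Fin d → ℝ) × (Fin d → ℝ), ℂ)) : ℂ :=
  ∫ p, ph (ℓ p) * (σ (p + c) * pft Φ p)

theorem exists_gab_bound {m : ℝ} {σ : (Fin d → ℝ) × (Fin d → ℝ) → ℂ}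
    {C₀ : ℝ} (hC₀ : ∀ z, ‖σ z‖ ≤ C₀ * jb2 z ^ m)
    {B : Set 𝓢((Fin d → ℝ) × (Fin d → ℝ), ℂ)} (hB : Bornology.IsVonNBounded ℝ B) :
    ∃ C : ℝ, 0 ≤ C ∧ ∀ Φ ∈ B, ∀ c ℓ, ‖gab σ ℓ c Φ‖ ≤ C * jb2 c ^ m := by
  obtain ⟨C, hC, h⟩ := exists_symbol_mul_pft_bound hC₀ hB
  refine ⟨C * ∫ p : (Fin d → ℝ) × (Fin d → ℝ), bump2 p,
    mul_nonneg hC (integral_nonneg bump2_nonneg), fun Φ hΦ c ℓ => ?_⟩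
  rw [mul_right_comm, ← integral_const_mul]
  refine norm_integral_le_of_norm_le (integrable_bump2.const_mul _)
    (Filter.Eventually.of_forall fun p => ?_)
  rw [norm_mul, norm_mul, norm_ph, one_mul]
  exact h Φ hΦ c p

theorem gab_by_parts {m : ℝ} {σ : (Fin d → ℝ) × (Fin d → ℝ) → ℂ} (hσ : ContDiff ℝ (⊤ : ℕ∞) σ)
    (v : (Fin d → ℝ) × (Fin d → ℝ)) {C₀ C₁ : ℝ} (hC₀ : ∀ z, ‖σ z‖ ≤ C₀ * jb2 z ^ m)
    (hC₁ : ∀ z, ‖pdir v σ z‖ ≤ C₁ * jb2 z ^ m)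
    (ℓ : (Fin d → ℝ) × (Fin d → ℝ) →L[ℝ] ℝ) (c : (Fin d → ℝ) × (Fin d → ℝ))
    (Φ : 𝓢((Fin d → ℝ) × (Fin d → ℝ), ℂ)) :
    2 * π * I * ℓ v * gab σ ℓ c Φ = -(gab (pdir v σ) ℓ c Φ + gab σ ℓ c (pftDeriv v Φ)) := by
  have hd : Continuous (pdir v σ) := by
    unfold pdir
    exact (hσ.continuous_fderiv (by simp)).clm_apply continuous_const
  have i1 := integrable_symbol_mul_pft hσ.continuous hC₀ Φ c
  have i2 := integrable_symbol_mul_pft hd hC₁ Φ c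
  have i3 := integrable_symbol_mul_pft hσ.continuous hC₀ (pftDeriv v Φ) c
  have key := integral_bilinear_hasLineDerivAt_right_eq_neg_left_of_integrable
    (μ := (volume : Measure ((Fin d → ℝ) × (Fin d → ℝ)))) (B := ContinuousLinearMap.mul ℝ ℂ)
    (v := v) (f := fun p => ph (ℓ p)) (f' := fun p => 2 * π * I * ℓ v * ph (ℓ p))
    (g := fun p => σ (p + c) * pft Φ p)
    (g' := fun p => pdir v σ (p + c) * pft Φ p + σ (p + c) * pft (pftDeriv v Φ) p) ?_ ?_ ?_ ?_ ?_
  · simp only [ContinuousLinearMap.mul_apply'] at key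
    simp only [mul_add] at key
    rw [integral_add (integrable_ph_mul i2 ℓ.continuous) (integrable_ph_mul i3 ℓ.continuous)]
      at key
    rw [gab, gab, gab, key, neg_neg]
    simp only [mul_assoc, integral_const_mul]
  · simp only [ContinuousLinearMap.mul_apply', mul_assoc]
    exact ((((integrable_ph_mul i1 ℓ.continuous).const_mul _).const_mul _).const_mul _).const_mul _
  · exact integrable_ph_mul (i2.add i3) ℓ.continuous
  · exact integrable_ph_mul i1 ℓ.continuous
  · exact fun p _ => hasLineDerivAt_ph ℓ p v
  · intro p _
    have h1 : HasLineDerivAt ℝ (fun p => σ (p + c)) (pdir v σ (p + c)) p v := by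
      have := (hasFDerivAt_comp_add_right c).2
        (hσ.differentiable (by simp) (p + c)).hasFDerivAt
      exact this.hasLineDerivAt v
    have := HasDerivAt.mul h1 (hasLineDerivAt_pft Φ p v)
    simp only [zero_smul, add_zero] at this
    exact this

theorem exists_gab_decay_dir {m : ℝ} (v : (Fin d → ℝ) × (Fin d → ℝ)) (N : ℕ) :
    ∀ {σ : (Fin d → ℝ) × (Fin d → ℝ) → ℂ}, ContDiff ℝ (⊤ : ℕ∞) σ →
      (∀ k : ℕ, ∃ C : ℝ, ∀ z, ‖(pdir v)^[k] σ z‖ ≤ C * jb2 z ^ m) →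
      ∀ {B : Set 𝓢((Fin d → ℝ) × (Fin d → ℝ), ℂ)}, Bornology.IsVonNBounded ℝ B →
      ∃ C : ℝ, 0 ≤ C ∧ ∀ Φ ∈ B, ∀ c ℓ, |ℓ v| ^ N * ‖gab σ ℓ c Φ‖ ≤ C * jb2 c ^ m := by
  induction N with
  | zero =>
    intro σ hσ hb B hB
    obtain ⟨C₀, hC₀⟩ := hb 0
    simpa using exists_gab_bound hC₀ hB
  | succ N ih =>
    intro σ hσ hb B hB
    obtain ⟨C₀, hC₀⟩ := hb 0
    obtain ⟨C₁, hC₁⟩ := hb 1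
    have hσ' : ContDiff ℝ (⊤ : ℕ∞) (pdir v σ) := by
      unfold pdir
      exact (hσ.fderiv_right (by simp)).clm_apply contDiff_const
    obtain ⟨D₁, hD₁, h₁⟩ := ih hσ' (fun k => hb (k + 1)) hB
    obtain ⟨D₂, hD₂, h₂⟩ := ih hσ hb (hB.image (pftDeriv v))
    refine ⟨D₁ + D₂, by positivity, fun Φ hΦ c ℓ => ?_⟩
    have e := congrArg norm (gab_by_parts hσ v hC₀ hC₁ ℓ c Φ)
    rw [norm_neg, norm_mul, norm_mul, norm_mul, norm_mul, Complex.norm_real, Complex.norm_real,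
      Complex.norm_I, Real.norm_eq_abs, Real.norm_eq_abs, abs_of_pos Real.pi_pos] at e
    have h2π : 1 ≤ ‖(2 : ℂ)‖ * π * 1 := by
      have := Real.pi_gt_three
      norm_num; linarith
    have e' : |ℓ v| * ‖gab σ ℓ c Φ‖ ≤ ‖gab (pdir v σ) ℓ c Φ‖ + ‖gab σ ℓ c (pftDeriv v Φ)‖ := by
      refine le_trans ?_ (norm_add_le _ _)
      rw [← e, mul_assoc]
      exact le_mul_of_one_le_left (by positivity) h2π
    calc |ℓ v| ^ (N + 1) * ‖gab σ ℓ c Φ‖ = |ℓ v| ^ N * (|ℓ v| * ‖gab σ ℓ c Φ‖) := by ring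
      _ ≤ |ℓ v| ^ N * (‖gab (pdir v σ) ℓ c Φ‖ + ‖gab σ ℓ c (pftDeriv v Φ)‖) := by gcongr
      _ = |ℓ v| ^ N * ‖gab (pdir v σ) ℓ c Φ‖ + |ℓ v| ^ N * ‖gab σ ℓ c (pftDeriv v Φ)‖ := by ring
      _ ≤ D₁ * jb2 c ^ m + D₂ * jb2 c ^ m :=
        add_le_add (h₁ Φ hΦ c ℓ) (h₂ _ (Set.mem_image_of_mem _ hΦ) c ℓ)
      _ = _ := by ring

theorem mpdList_replicate {E : Type*} [NormedAddCommGroup E] [NormedSpace ℝ E] (v : E)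
    (h : E → ℂ) (N : ℕ) : mpdList (List.replicate N v) h = (pdir v)^[N] h := by
  induction N with
  | zero => rfl
  | succ N ih =>
    rw [Function.iterate_succ_apply', ← ih]; rfl

theorem stdList_single (j : Fin d) (N : ℕ) :
    stdList d (Pi.single j N) = List.replicate N (Pi.single j 1) := by
  have aux : ∀ l : List (Fin d), l.Nodup →
      (l.flatMap fun i => List.replicate ((Pi.single j N : Fin d → ℕ) i)
        (Pi.single i 1 : Fin d → ℝ)) =
      if j ∈ l then List.replicate N (Pi.single j 1) else [] := by
    intro l hl
    induction l with
    | nil => simp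
    | cons a l ih =>
      rw [List.nodup_cons] at hl
      rw [List.flatMap_cons, ih hl.2]
      by_cases ha : j = a
      · subst ha; simp [hl.1]
      · simp [ha]
  rw [stdList, aux _ (List.nodup_finRange d)]
  simp

theorem stdList_zero : stdList d 0 = [] := by
  simp [stdList]

theorem SmSymbol.exists_iterate_fst_bound {m : ℝ} {σ : (Fin d → ℝ) × (Fin d → ℝ) → ℂ}
    (hσ : SmSymbol d m σ) (j : Fin d) (k : ℕ) :
    ∃ C : ℝ, ∀ z, ‖(pdir ((Pi.single j 1 : Fin d → ℝ), (0 : Fin d → ℝ)))^[k] σ z‖ ≤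
      C * jb2 z ^ m := by
  have := hσ.2 (Pi.single j k, 0)
  rwa [mpd2, stdList2, stdList_single, stdList_zero, List.map_replicate, List.map_nil,
    List.append_nil, mpdList_replicate] at this

theorem SmSymbol.exists_iterate_snd_bound {m : ℝ} {σ : (Fin d → ℝ) × (Fin d → ℝ) → ℂ}
    (hσ : SmSymbol d m σ) (j : Fin d) (k : ℕ) :
    ∃ C : ℝ, ∀ z, ‖(pdir ((0 : Fin d → ℝ), (Pi.single j 1 : Fin d → ℝ)))^[k] σ z‖ ≤
      C * jb2 z ^ m := by
  have := hσ.2 (0, Pi.single j k)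
  rwa [mpd2, stdList2, stdList_single, stdList_zero, List.map_replicate, List.map_nil,
    List.nil_append, mpdList_replicate] at this

theorem SmSymbol.exists_bound {m : ℝ} {σ : (Fin d → ℝ) × (Fin d → ℝ) → ℂ}
    (hσ : SmSymbol d m σ) : ∃ C : ℝ, ∀ z, ‖σ z‖ ≤ C * jb2 z ^ m := by
  have := hσ.2 (0, 0)
  rwa [mpd2, stdList2, stdList_zero, List.map_nil, List.map_nil, List.append_nil] at this

/-- The functional `p ↦ u₁ · p₂ - u₂ · p₁`. -/
def sympL (u : (Fin d → ℝ) × (Fin d → ℝ)) : (Fin d → ℝ) × (Fin d → ℝ) →L[ℝ] ℝ :=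
  dotL u.1 ∘L ContinuousLinearMap.snd ℝ _ _ - dotL u.2 ∘L ContinuousLinearMap.fst ℝ _ _

theorem sympL_apply (u p : (Fin d → ℝ) × (Fin d → ℝ)) :
    sympL u p = p.2 ⬝ᵥ u.1 - p.1 ⬝ᵥ u.2 := rfl

theorem exists_gab_decay {m : ℝ} {σ : (Fin d → ℝ) × (Fin d → ℝ) → ℂ}
    (hσ : SmSymbol d m σ)
    {B : Set 𝓢((Fin d → ℝ) × (Fin d → ℝ), ℂ)} (hB : Bornology.IsVonNBounded ℝ B) (N : ℕ) :
    ∃ C : ℝ, 0 ≤ C ∧ ∀ Φ ∈ B, ∀ c u,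
      (1 + ‖u‖) ^ N * ‖gab σ (sympL u) c Φ‖ ≤ C * jb2 c ^ m := by
  obtain ⟨C₀, hC₀⟩ := hσ.exists_bound
  obtain ⟨D₀, hD₀, h₀⟩ := exists_gab_bound hC₀ hB
  choose D₁ hD₁ h₁ using fun j : Fin d =>
    exists_gab_decay_dir _ N hσ.1 (hσ.exists_iterate_fst_bound j) hB
  choose D₂ hD₂ h₂ using fun j : Fin d =>
    exists_gab_decay_dir _ N hσ.1 (hσ.exists_iterate_snd_bound j) hB
  have s1 : 0 ≤ ∑ j, D₁ j := Finset.sum_nonneg fun j _ => hD₁ j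
  have s2 : 0 ≤ ∑ j, D₂ j := Finset.sum_nonneg fun j _ => hD₂ j
  refine ⟨2 ^ N * (D₀ + ∑ j, D₂ j) + 2 ^ N * (D₀ + ∑ j, D₁ j), by positivity,
    fun Φ hΦ c u => ?_⟩
  set G := ‖gab σ (sympL u) c Φ‖ with hG
  have hG0 : 0 ≤ G := norm_nonneg _
  have b0 : G ≤ D₀ * jb2 c ^ m := h₀ Φ hΦ c _
  have b1 : ∀ j, |u.2 j| ^ N * G ≤ D₁ j * jb2 c ^ m := fun j => by
    have := h₁ j Φ hΦ c (sympL u)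
    rw [sympL_apply] at this
    simpa using this
  have b2 : ∀ j, |u.1 j| ^ N * G ≤ D₂ j * jb2 c ^ m := fun j => by
    have := h₂ j Φ hΦ c (sympL u)
    rw [sympL_apply] at this
    simpa using this
  have hu : (1 + ‖u‖) ^ N ≤ (1 + ‖u.1‖) ^ N + (1 + ‖u.2‖) ^ N := by
    rw [Prod.norm_def]
    rcases max_choice ‖u.1‖ ‖u.2‖ with h | h <;> rw [h]
    · exact le_add_of_nonneg_right (by positivity)
    · exact le_add_of_nonneg_left (by positivity)
  have aux : ∀ (w : Fin d → ℝ) (D : Fin d → ℝ), (∀ j, |w j| ^ N * G ≤ D j * jb2 c ^ m) →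
      (1 + ‖w‖) ^ N * G ≤ 2 ^ N * (D₀ + ∑ j, D j) * jb2 c ^ m := by
    intro w D hw
    calc (1 + ‖w‖) ^ N * G ≤ 2 ^ N * (1 + ∑ j, |w j| ^ N) * G := by
          gcongr; exact one_add_norm_pow_le w N
      _ = 2 ^ N * (G + ∑ j, |w j| ^ N * G) := by rw [← Finset.sum_mul]; ring
      _ ≤ 2 ^ N * (D₀ * jb2 c ^ m + ∑ j, D j * jb2 c ^ m) := by
          refine mul_le_mul_of_nonneg_left (add_le_add b0 ?_) (by positivity)
          exact Finset.sum_le_sum fun j _ => hw j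
      _ = _ := by rw [← Finset.sum_mul]; ring
  calc (1 + ‖u‖) ^ N * G ≤ ((1 + ‖u.1‖) ^ N + (1 + ‖u.2‖) ^ N) * G := by gcongr
    _ = (1 + ‖u.1‖) ^ N * G + (1 + ‖u.2‖) ^ N * G := add_mul _ _ _
    _ ≤ _ := add_le_add (aux u.1 D₂ b2) (aux u.2 D₁ b1)
    _ = _ := by ring

/-! ### The reproducing formula of the short-time Fourier transform -/

theorem fourier_inversion_pi {h : (Fin d → ℝ) → ℂ} (hc : Continuous h) (hi : Integrable h)
    (hF : Integrable fun ω : Fin d → ℝ => ∫ y, ph (-(y ⬝ᵥ ω)) * h y) (t : Fin d → ℝ) :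
    ∫ ω : Fin d → ℝ, ph (ω ⬝ᵥ t) * ∫ y, ph (-(y ⬝ᵥ ω)) * h y = h t := by
  have hmp := PiLp.volume_preserving_ofLp (Fin d)
  have hme : MeasurableEmbedding (@WithLp.ofLp 2 (Fin d → ℝ)) :=
    (MeasurableEquiv.toLp 2 (Fin d → ℝ)).symm.measurableEmbedding
  set H : EuclideanSpace ℝ (Fin d) → ℂ := fun v => h (WithLp.ofLp v) with hH
  have hHc : Continuous H := hc.comp (PiLp.continuous_ofLp 2 _)
  have hHi : Integrable H := (hmp.integrable_comp_emb hme).2 hi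
  have hFt : FourierTransform.fourier H =
      fun ξ => (fun ω : Fin d → ℝ => ∫ y, ph (-(y ⬝ᵥ ω)) * h y) (WithLp.ofLp ξ) := by
    funext ξ
    rw [Real.fourier_eq]
    simp only
    rw [← hmp.integral_comp hme]
    refine integral_congr_ae (Filter.Eventually.of_forall fun v => ?_)
    simp only [hH, ph_eq_fourierChar, EuclideanSpace.inner_eq_star_dotProduct, star_trivial]
    rw [dotProduct_comm]; rfl
  have hFi : Integrable (FourierTransform.fourier H) := by
    rw [hFt]
    exact (hmp.integrable_comp_emb hme).2 hF
  have key := congrFun (hHc.fourierInv_fourier_eq hHi hFi) (WithLp.toLp 2 t)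
  rw [Real.fourierInv_eq, hFt] at key
  refine Eq.trans ?_ key
  rw [← hmp.integral_comp hme]
  refine integral_congr_ae (Filter.Eventually.of_forall fun v => ?_)
  simp only [ph_eq_fourierChar, EuclideanSpace.inner_eq_star_dotProduct, star_trivial]
  rw [dotProduct_comm]; rfl

theorem stft_eq_pft (g f : 𝓢(Fin d → ℝ, ℂ)) (x ω : Fin d → ℝ) :
    stft g f x ω = pft (stftPair g f) (x, -ω) := by
  rw [stft_eq, pft]
  refine integral_congr_ae (Filter.Eventually.of_forall fun y => ?_)
  simp only [stftPair_apply, dotProduct_neg, dotProduct_comm ω y, mul_assoc]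

theorem continuous_stft (g f : 𝓢(Fin d → ℝ, ℂ)) : Continuous (Function.uncurry (stft g f)) := by
  have : Function.uncurry (stft (⇑g) (⇑f)) = fun w => pft (stftPair g f) (w.1, -w.2) := by
    funext w; exact stft_eq_pft g f w.1 w.2
  rw [this]
  have := continuous_pft (stftPair g f)
  fun_prop

theorem exists_stft_decay (g f : 𝓢(Fin d → ℝ, ℂ)) (K : ℕ) :
    ∃ C : ℝ, 0 ≤ C ∧ ∀ w : (Fin d → ℝ) × (Fin d → ℝ),
      (1 + ‖w‖) ^ K * ‖stft g f w.1 w.2‖ ≤ C := by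
  obtain ⟨C, hC, h⟩ := exists_pft_bound_single (stftPair g f) K
  refine ⟨C, hC, fun w => ?_⟩
  have := h (w.1, -w.2)
  rw [← stft_eq_pft] at this
  simpa [Prod.norm_def] using this

theorem integrable_stft_mul_pow (g f : 𝓢(Fin d → ℝ, ℂ)) (K : ℕ) :
    Integrable fun w : (Fin d → ℝ) × (Fin d → ℝ) => (1 + ‖w‖) ^ K * ‖stft g f w.1 w.2‖ := by
  obtain ⟨C, hC, h⟩ := exists_stft_decay g f (K + (2 * d + 1))
  refine (integrable_bump2.const_mul C).mono' ?_ (Filter.Eventually.of_forall fun w => ?_)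
  · have := continuous_stft g f
    exact Continuous.aestronglyMeasurable (((continuous_const.add continuous_norm).pow K).mul
      this.norm)
  · rw [Real.norm_of_nonneg (by positivity), bump2, ← div_eq_mul_inv, le_div_iff₀ (by positivity)]
    refine le_trans (le_of_eq ?_) (h w)
    rw [pow_add _ K (2 * d + 1)]; ring

theorem integrable_stft (g f : 𝓢(Fin d → ℝ, ℂ)) :
    Integrable (Function.uncurry (stft g f)) := by
  have := integrable_stft_mul_pow g f 0
  simp only [pow_zero, one_mul] at this
  exact (integrable_norm_iff (continuous_stft g f).aestronglyMeasurable).1 this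

theorem lintegral_stft_ne_top (g f : 𝓢(Fin d → ℝ, ℂ)) :
    ∫⁻ w, ‖Function.uncurry (stft g f) w‖ₑ ≠ ∞ :=
  (integrable_stft g f).2.ne

/-- The squared `L²`-norm of `g`, as a complex number. -/
def sqNorm (g : (Fin d → ℝ) → ℂ) : ℂ := ∫ x, g x * (starRingEnd ℂ) (g x)

theorem sqNorm_ne_zero {g : 𝓢(Fin d → ℝ, ℂ)} (hg : g ≠ 0) : sqNorm g ≠ 0 := by
  have e : sqNorm g = ((∫ x, ‖g x‖ ^ 2 : ℝ) : ℂ) := by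
    rw [sqNorm, ← integral_complex_ofReal]
    refine integral_congr_ae (Filter.Eventually.of_forall fun x => ?_)
    simp only [Complex.mul_conj, Complex.normSq_eq_norm_sq]
  rw [e, Complex.ofReal_ne_zero]
  obtain ⟨x, hx⟩ : ∃ x, g x ≠ 0 := by
    by_contra! h
    exact hg (by ext x; simpa using h x)
  have hc : Continuous fun x => ‖g x‖ ^ 2 := by have := g.continuous; fun_prop
  have hi : Integrable fun x => ‖g x‖ ^ 2 := (g.memLp 2).integrable_norm_pow (by simp)
  exact (integral_pos_of_integrable_nonneg_nonzero hc hi (fun x => by positivity)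
    (x := x) (by simpa using hx)).ne'

theorem exists_schwartz_norm_le (g : 𝓢(Fin d → ℝ, ℂ)) : ∃ C : ℝ, 0 ≤ C ∧ ∀ x, ‖g x‖ ≤ C := by
  obtain ⟨C, hC, h⟩ :=
    exists_decay_of_isVonNBounded (Bornology.isVonNBounded_singleton (𝕜 := ℝ) g) 0
  exact ⟨C, hC, fun x => by simpa using h g rfl x⟩

/-- The reproducing formula `‖g‖² f = ∫ V_g f(w) π(w)g dw`. -/
theorem integral_stft_mul_tshift (g f : 𝓢(Fin d → ℝ, ℂ)) (t : Fin d → ℝ) :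
    ∫ w : (Fin d → ℝ) × (Fin d → ℝ), stft g f w.1 w.2 * tshift w g t = sqNorm g * f t := by
  obtain ⟨Cg, -, hCg⟩ := exists_schwartz_norm_le g
  have hi : Integrable fun w : (Fin d → ℝ) × (Fin d → ℝ) =>
      stft g f w.1 w.2 * tshift w g t := by
    refine (integrable_stft g f).mul_bdd (c := Cg) ?_ (Filter.Eventually.of_forall fun w => ?_)
    · simp only [tshift_eq]
      have := g.continuous
      exact Continuous.aestronglyMeasurable (by fun_prop)
    · rw [tshift_eq, norm_mul, norm_ph, one_mul]; exact hCg _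
  rw [Measure.volume_eq_prod, integral_prod _ (by simpa [Measure.volume_eq_prod] using hi)]
  have inner : ∀ x : Fin d → ℝ, ∫ ω : Fin d → ℝ, stft g f x ω * tshift (x, ω) g t =
      f t * (g (t - x) * (starRingEnd ℂ) (g (t - x))) := by
    intro x
    have hs : ∀ ω, stft g f x ω =
        ∫ y, ph (-(y ⬝ᵥ ω)) * (f y * (starRingEnd ℂ) (g (y - x))) := by
      intro ω
      rw [stft_eq]
      refine integral_congr_ae (Filter.Eventually.of_forall fun y => ?_)
      simp only [dotProduct_comm ω y, mul_assoc]
    have hc : Continuous fun y => f y * (starRingEnd ℂ) (g (y - x)) := by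
      have := g.continuous
      exact f.continuous.mul (continuous_conj.comp (this.comp (by fun_prop)))
    have hint : Integrable fun y => f y * (starRingEnd ℂ) (g (y - x)) := by
      have := integrable_slice (stftPair g f) x
      simpa only [stftPair_apply] using this
    have hF : Integrable fun ω : Fin d → ℝ =>
        ∫ y, ph (-(y ⬝ᵥ ω)) * (f y * (starRingEnd ℂ) (g (y - x))) := by
      simp only [← hs]
      obtain ⟨C, hC, h⟩ := exists_stft_decay g f (d + 1)
      refine (integrable_bump.const_mul C).mono' ?_ (Filter.Eventually.of_forall fun ω => ?_)
      · exact ((continuous_stft g f).comp (by fun_prop : Continuous fun ω => (x, ω))).aestronglyMeasurable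
      · rw [bump, ← div_eq_mul_inv, le_div_iff₀ (by positivity), mul_comm]
        refine le_trans ?_ (h (x, ω))
        gcongr
        exact norm_snd_le (x, ω)
    have key := fourier_inversion_pi hc hint hF t
    simp only [← hs] at key
    simp only [tshift_eq]
    calc ∫ ω : Fin d → ℝ, stft g f x ω * (ph (ω ⬝ᵥ t) * g (t - x))
        = (∫ ω : Fin d → ℝ, ph (ω ⬝ᵥ t) * stft g f x ω) * g (t - x) := by
          rw [← integral_mul_const]
          refine integral_congr_ae (Filter.Eventually.of_forall fun ω => ?_)
          simp only; ring
      _ = _ := by rw [key]; ring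
  simp only [inner]
  rw [integral_const_mul, mul_comm, sqNorm]
  congr 1
  exact integral_sub_left_eq_self (fun x => g x * (starRingEnd ℂ) (g x)) volume t

theorem le_rpow_neg_of_pow_mul_le {u a C M : ℝ} (hu : 0 ≤ u) (ha : 0 ≤ a)
    (h : (1 + u) ^ ⌈M⌉₊ * a ≤ C) : a ≤ C * (1 + u) ^ (-M) := by
  rw [Real.rpow_neg (by positivity), ← div_eq_mul_inv, le_div_iff₀ (by positivity), mul_comm]
  refine le_trans ?_ h
  gcongr
  rw [← Real.rpow_natCast]
  exact Real.rpow_le_rpow_of_exponent_le (by linarith) (Nat.le_ceil M)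

theorem enorm_le_of_mul_eq_integral {c U : ℂ} (hc : c ≠ 0)
    {V F : (Fin d → ℝ) × (Fin d → ℝ) → ℂ} (h : c * U = ∫ w, F w)
    {z : (Fin d → ℝ) × (Fin d → ℝ)} {D M : ℝ} (hD : 0 ≤ D)
    (hb : ∀ w, ‖F w‖ ≤ D * ((1 + ‖z - w‖) ^ (-M)) * ‖V w‖) :
    ‖U‖ₑ ≤ ENNReal.ofReal (D / ‖c‖) * ∫⁻ w, ‖V w‖ₑ * dec M (z - w) := by
  have hU : U = ∫ w, c⁻¹ * F w := by
    rw [integral_const_mul, ← h, inv_mul_cancel_left₀ hc]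
  rw [hU, ← lintegral_const_mul' _ _ ENNReal.ofReal_ne_top]
  refine (enorm_integral_le_lintegral_enorm _).trans (lintegral_mono fun w => ?_)
  rw [dec, ← ofReal_norm, ← ofReal_norm, ← ENNReal.ofReal_mul (norm_nonneg _),
    ← ENNReal.ofReal_mul (by positivity)]
  refine ENNReal.ofReal_le_ofReal ?_
  rw [norm_mul, norm_inv]
  calc ‖c‖⁻¹ * ‖F w‖ ≤ ‖c‖⁻¹ * (D * ((1 + ‖z - w‖) ^ (-M)) * ‖V w‖) := by gcongr; exact hb w
    _ = _ := by ring

theorem integral_tshift_mul_conj_tshift (g : 𝓢(Fin d → ℝ, ℂ))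
    (z w : (Fin d → ℝ) × (Fin d → ℝ)) :
    ‖∫ y, ph (-(z.2 ⬝ᵥ y)) * (starRingEnd ℂ) (g (y - z.1)) * tshift w g y‖ =
      ‖stft g g (z - w).1 (z - w).2‖ := by
  have e : ∫ y, ph (-(z.2 ⬝ᵥ y)) * (starRingEnd ℂ) (g (y - z.1)) * tshift w g y =
      ph (-((z - w).2 ⬝ᵥ w.1)) * stft g g (z - w).1 (z - w).2 := by
    rw [stft_eq, ← integral_const_mul,
      ← integral_add_right_eq_self (μ := (volume : Measure (Fin d → ℝ)))
        (fun y => ph (-(z.2 ⬝ᵥ y)) * (starRingEnd ℂ) (g (y - z.1)) * tshift w g y) w.1]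
    refine integral_congr_ae (Filter.Eventually.of_forall fun y => ?_)
    simp only [tshift_eq, Prod.fst_sub, Prod.snd_sub]
    rw [add_sub_cancel_right, show y + w.1 - z.1 = y - (z.1 - w.1) by abel]
    have : ph (-(z.2 ⬝ᵥ (y + w.1))) * ph (w.2 ⬝ᵥ (y + w.1)) =
        ph (-((z.2 - w.2) ⬝ᵥ w.1)) * ph (-((z.2 - w.2) ⬝ᵥ y)) := by
      rw [← ph_add, ← ph_add]; congr 1
      simp only [dotProduct_add, sub_dotProduct]; ring
    linear_combination (starRingEnd ℂ) (g (y - (z.1 - w.1))) * g y * this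
  rw [e, norm_mul, norm_ph, one_mul]

theorem sqNorm_mul_stft (g f : 𝓢(Fin d → ℝ, ℂ)) (z : (Fin d → ℝ) × (Fin d → ℝ)) :
    sqNorm g * stft g f z.1 z.2 = ∫ w : (Fin d → ℝ) × (Fin d → ℝ), stft g f w.1 w.2 *
      ∫ y, ph (-(z.2 ⬝ᵥ y)) * (starRingEnd ℂ) (g (y - z.1)) * tshift w g y := by
  obtain ⟨Cg, -, hCg⟩ := exists_schwartz_norm_le g
  have hgc := g.continuous
  have hprod : Integrable (Function.uncurry fun (y : Fin d → ℝ)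
      (w : (Fin d → ℝ) × (Fin d → ℝ)) => ph (-(z.2 ⬝ᵥ y)) * (starRingEnd ℂ) (g (y - z.1)) *
        (stft g f w.1 w.2 * tshift w g y)) (volume.prod volume) := by
    have h1 : Integrable fun y => ph (-(z.2 ⬝ᵥ y)) * (starRingEnd ℂ) (g (y - z.1)) := by
      refine integrable_ph_mul ?_ (by fun_prop)
      simpa only [conjS_apply] using (conjS g).integrable.comp_sub_right z.1
    have h2 := h1.mul_prod (integrable_stft g f)
    refine (h2.mul_bdd (c := Cg) (g := fun q : (Fin d → ℝ) × ((Fin d → ℝ) × (Fin d → ℝ)) =>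
      tshift q.2 g q.1) ?_ (Filter.Eventually.of_forall fun q => ?_)).congr
      (Filter.Eventually.of_forall fun q => ?_)
    · simp only [tshift_eq]
      exact Continuous.aestronglyMeasurable (by fun_prop)
    · rw [tshift_eq, norm_mul, norm_ph, one_mul]; exact hCg _
    · simp only [Function.uncurry]; ring
  rw [stft_eq, ← integral_const_mul]
  calc ∫ y, sqNorm g * (ph (-(z.2 ⬝ᵥ y)) * f y * (starRingEnd ℂ) (g (y - z.1)))
      = ∫ y, ∫ w : (Fin d → ℝ) × (Fin d → ℝ), ph (-(z.2 ⬝ᵥ y)) *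
          (starRingEnd ℂ) (g (y - z.1)) * (stft g f w.1 w.2 * tshift w g y) := by
        refine integral_congr_ae (Filter.Eventually.of_forall fun y => ?_)
        simp only
        rw [integral_const_mul, integral_stft_mul_tshift]; ring
    _ = ∫ w : (Fin d → ℝ) × (Fin d → ℝ), ∫ y, ph (-(z.2 ⬝ᵥ y)) *
          (starRingEnd ℂ) (g (y - z.1)) * (stft g f w.1 w.2 * tshift w g y) :=
        integral_integral_swap hprod
    _ = _ := by
        refine integral_congr_ae (Filter.Eventually.of_forall fun w => ?_)
        simp only
        rw [← integral_const_mul]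
        refine integral_congr_ae (Filter.Eventually.of_forall fun y => ?_)
        simp only; ring

theorem exists_stft_reproducing {g : 𝓢(Fin d → ℝ, ℂ)} (hg : g ≠ 0) (M : ℝ) :
    ∃ C : ℝ≥0∞, C ≠ ∞ ∧ ∀ (f : 𝓢(Fin d → ℝ, ℂ)) (z : (Fin d → ℝ) × (Fin d → ℝ)),
      ‖Function.uncurry (stft g f) z‖ₑ ≤
        C * ∫⁻ w, ‖Function.uncurry (stft g f) w‖ₑ * dec M (z - w) := by
  obtain ⟨D, hD, h⟩ := exists_stft_decay g g ⌈M⌉₊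
  refine ⟨ENNReal.ofReal (D / ‖sqNorm g‖), ENNReal.ofReal_ne_top, fun f z => ?_⟩
  refine enorm_le_of_mul_eq_integral (sqNorm_ne_zero hg) (sqNorm_mul_stft g f z) hD fun w => ?_
  rw [norm_mul, integral_tshift_mul_conj_tshift, mul_comm]
  exact mul_le_mul_of_nonneg_right
    (le_rpow_neg_of_pow_mul_le (norm_nonneg _) (norm_nonneg _) (h (z - w))) (norm_nonneg _)

/-! ### The Gabor matrix of `Op_τ(σ)` -/

theorem integrable_uncurry_of_norm_le_shift {X Y : Type*} [MeasurableSpace X]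
    [NormedAddCommGroup Y] [MeasurableSpace Y] [BorelSpace Y] {μ : Measure X} [SFinite μ]
    {ν : Measure Y} [SFinite ν] [ν.IsAddRightInvariant] {F : X → Y → ℂ}
    (hF : AEStronglyMeasurable (Function.uncurry F) (μ.prod ν)) {b : X → ℝ} (hb : Integrable b μ)
    {h : Y → ℝ} (hh : Integrable h ν) {s : X → Y} (hle : ∀ x y, ‖F x y‖ ≤ b x * h (y - s x)) :
    Integrable (Function.uncurry F) (μ.prod ν) := by
  have hi : ∀ x, Integrable (fun y => b x * h (y - s x)) ν := fun x =>
    (hh.comp_sub_right (s x)).const_mul _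
  rw [integrable_prod_iff hF]
  constructor
  · filter_upwards [hF.prodMk_left] with x hx
    exact (hi x).mono' hx (Filter.Eventually.of_forall (hle x))
  · refine (hb.mul_const (∫ y, h y ∂ν)).mono' hF.norm.integral_prod_right'
      (Filter.Eventually.of_forall fun x => ?_)
    rw [Real.norm_of_nonneg (integral_nonneg fun y => norm_nonneg _),
      ← integral_sub_right_eq_self h (s x), ← integral_const_mul]
    exact integral_mono_of_nonneg (Filter.Eventually.of_forall fun y => norm_nonneg _) (hi x)
      (Filter.Eventually.of_forall (hle x))

/-- The point `((1-τ)z₁ + τw₁, τz₂ + (1-τ)w₂)` at which the Gabor matrix samples the symbol. -/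
def tauMid (τ : ℝ) (z w : (Fin d → ℝ) × (Fin d → ℝ)) : (Fin d → ℝ) × (Fin d → ℝ) :=
  ((1 - τ) • z.1 + τ • w.1, τ • z.2 + (1 - τ) • w.2)

theorem continuous_tauMid (τ : ℝ) (z : (Fin d → ℝ) × (Fin d → ℝ)) :
    Continuous (tauMid τ z) := by
  unfold tauMid; fun_prop

theorem norm_tauMid_sub_le {τ : ℝ} (hτ : τ ∈ Set.Icc (0 : ℝ) 1)
    (z w : (Fin d → ℝ) × (Fin d → ℝ)) : ‖tauMid τ z w - z‖ ≤ ‖z - w‖ := by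
  have h1 : (tauMid τ z w - z).1 = -(τ • (z - w).1) := by
    simp only [tauMid, Prod.fst_sub]; module
  have h2 : (tauMid τ z w - z).2 = -((1 - τ) • (z - w).2) := by
    simp only [tauMid, Prod.snd_sub]; module
  have hτ' : ‖τ‖ ≤ 1 := by rw [Real.norm_eq_abs, abs_le]; constructor <;> linarith [hτ.1, hτ.2]
  have hτ'' : ‖1 - τ‖ ≤ 1 := by rw [Real.norm_eq_abs, abs_le]; constructor <;> linarith [hτ.1, hτ.2]
  rw [Prod.norm_def, h1, h2, norm_neg, norm_neg, norm_smul, norm_smul]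
  exact max_le
    ((mul_le_of_le_one_left (norm_nonneg _) hτ').trans (norm_fst_le _))
    ((mul_le_of_le_one_left (norm_nonneg _) hτ'').trans (norm_snd_le _))

theorem jb2_tauMid_rpow_le {τ : ℝ} (hτ : τ ∈ Set.Icc (0 : ℝ) 1) (m : ℝ)
    (z w : (Fin d → ℝ) × (Fin d → ℝ)) :
    jb2 (tauMid τ z w) ^ m ≤
      (2 * (1 + 2 * d)) ^ |m| * (jb2 z ^ m * (1 + ‖z - w‖) ^ |m|) := by
  refine (jb2_rpow_le m (tauMid τ z w) z).trans ?_
  have := Real.rpow_nonneg (jb2_pos z).le m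
  gcongr
  exact norm_tauMid_sub_le hτ z w

theorem conj_tshift_mul_tshift (g : 𝓢(Fin d → ℝ, ℂ)) {τ : ℝ} (hτ : τ ∈ Set.Icc (0 : ℝ) 1)
    (z w p : (Fin d → ℝ) × (Fin d → ℝ)) (y : Fin d → ℝ) :
    (starRingEnd ℂ) (tshift z g (p.1 + τ • y)) * tshift w g (p.1 - (1 - τ) • y) =
      ph (w.2 ⬝ᵥ (p.1 - (1 - τ) • y) - z.2 ⬝ᵥ (p.1 + τ • y)) *
        tauPair g hτ ((p - tauMid τ z w).1, y - (z.1 - w.1)) := by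
  rw [tauPair_apply, tshift_eq, tshift_eq, map_mul, conj_ph, sub_eq_add_neg (w.2 ⬝ᵥ _), ph_add]
  have e1 : (p - tauMid τ z w).1 + τ • (y - (z.1 - w.1)) = p.1 + τ • y - z.1 := by
    simp only [tauMid, Prod.fst_sub]; module
  have e2 : (p - tauMid τ z w).1 + (-(1 - τ)) • (y - (z.1 - w.1)) =
      p.1 - (1 - τ) • y - w.1 := by
    simp only [tauMid, Prod.fst_sub]; module
  simp only [e1, e2]
  ring

theorem integral_ph_mul_tshift_pair (g : 𝓢(Fin d → ℝ, ℂ)) {τ : ℝ} (hτ : τ ∈ Set.Icc (0 : ℝ) 1)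
    (z w p : (Fin d → ℝ) × (Fin d → ℝ)) :
    ∫ y, ph (y ⬝ᵥ p.2) *
        ((starRingEnd ℂ) (tshift z g (p.1 + τ • y)) * tshift w g (p.1 - (1 - τ) • y)) =
      ph (-((z - w).2 ⬝ᵥ (tauMid τ z w).1)) * (ph (sympL (z - w) (p - tauMid τ z w)) *
        pft (tauPair g hτ) (p - tauMid τ z w)) := by
  simp only [conj_tshift_mul_tshift g hτ]
  rw [← integral_add_right_eq_self (μ := (volume : Measure (Fin d → ℝ))) _ (z.1 - w.1), pft,
    ← integral_const_mul, ← integral_const_mul]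
  refine integral_congr_ae (Filter.Eventually.of_forall fun y => ?_)
  simp only [add_sub_cancel_right]
  simp only [← mul_assoc, ← ph_add]
  congr 2
  simp only [sympL_apply, tauMid, Prod.fst_sub, Prod.snd_sub, dotProduct_add, add_dotProduct,
    dotProduct_sub, sub_dotProduct, dotProduct_smul, smul_dotProduct, smul_eq_mul, smul_add,
    smul_sub]
  simp only [dotProduct_comm _ z.1, dotProduct_comm _ w.1, dotProduct_comm _ y,
    dotProduct_comm _ p.1]
  ring

theorem sqNorm_mul_conj_wig (g f : 𝓢(Fin d → ℝ, ℂ)) {τ : ℝ} (hτ : τ ∈ Set.Icc (0 : ℝ) 1)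
    (z p : (Fin d → ℝ) × (Fin d → ℝ)) :
    sqNorm g * (starRingEnd ℂ) (wig τ (tshift z g) f p) =
      ∫ w : (Fin d → ℝ) × (Fin d → ℝ), stft g f w.1 w.2 *
        (ph (-((z - w).2 ⬝ᵥ (tauMid τ z w).1)) * (ph (sympL (z - w) (p - tauMid τ z w)) *
          pft (tauPair g hτ) (p - tauMid τ z w))) := by
  have hgc := g.continuous
  have hs : Continuous fun w : (Fin d → ℝ) × (Fin d → ℝ) => stft g f w.1 w.2 :=
    continuous_stft g f
  obtain ⟨C, hC, hb⟩ := exists_slice_bound_single (tauPair g hτ)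
  have hprod : Integrable (Function.uncurry fun (w : (Fin d → ℝ) × (Fin d → ℝ))
      (y : Fin d → ℝ) => stft g f w.1 w.2 * (ph (y ⬝ᵥ p.2) *
        ((starRingEnd ℂ) (tshift z g (p.1 + τ • y)) * tshift w g (p.1 - (1 - τ) • y))))
      (volume.prod volume) := by
    refine integrable_uncurry_of_norm_le_shift ?_ (integrable_stft g f).norm
      (integrable_bump.const_mul C) (s := fun w => z.1 - w.1) fun w y => ?_
    · simp only [tshift_eq, Function.uncurry_def]
      have hs' : Continuous fun q : ((Fin d → ℝ) × (Fin d → ℝ)) × (Fin d → ℝ) =>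
        stft g f q.1.1 q.1.2 := hs.comp continuous_fst
      exact Continuous.aestronglyMeasurable (hs'.mul (by fun_prop))
    · rw [conj_tshift_mul_tshift g hτ, norm_mul, norm_mul, norm_mul, norm_ph, norm_ph,
        one_mul, one_mul]
      exact mul_le_mul_of_nonneg_left (hb _ _) (norm_nonneg _)
  have e : (starRingEnd ℂ) (wig τ (tshift z g) f p) = ∫ y, ph (y ⬝ᵥ p.2) *
      (starRingEnd ℂ) (tshift z g (p.1 + τ • y)) * f (p.1 - (1 - τ) • y) := by
    rw [wig_eq, ← integral_conj]
    refine integral_congr_ae (Filter.Eventually.of_forall fun y => ?_)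
    simp only [map_mul, conj_ph, neg_neg, Complex.conj_conj]
  rw [e, ← integral_const_mul]
  calc ∫ y, sqNorm g * (ph (y ⬝ᵥ p.2) *
        (starRingEnd ℂ) (tshift z g (p.1 + τ • y)) * f (p.1 - (1 - τ) • y))
      = ∫ y, ∫ w : (Fin d → ℝ) × (Fin d → ℝ), stft g f w.1 w.2 * (ph (y ⬝ᵥ p.2) *
        ((starRingEnd ℂ) (tshift z g (p.1 + τ • y)) * tshift w g (p.1 - (1 - τ) • y))) := by
        refine integral_congr_ae (Filter.Eventually.of_forall fun y => ?_)
        simp only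
        rw [mul_left_comm, ← integral_stft_mul_tshift, ← integral_const_mul]
        refine integral_congr_ae (Filter.Eventually.of_forall fun w => ?_)
        simp only; ring
    _ = ∫ w : (Fin d → ℝ) × (Fin d → ℝ), ∫ y, stft g f w.1 w.2 * (ph (y ⬝ᵥ p.2) *
        ((starRingEnd ℂ) (tshift z g (p.1 + τ • y)) * tshift w g (p.1 - (1 - τ) • y))) :=
        (integral_integral_swap hprod).symm
    _ = _ := by
        refine integral_congr_ae (Filter.Eventually.of_forall fun w => ?_)
        simp only
        rw [integral_const_mul, integral_ph_mul_tshift_pair g hτ]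

theorem sqNorm_mul_vOpTau {m : ℝ} {σ : (Fin d → ℝ) × (Fin d → ℝ) → ℂ} (hσ : SmSymbol d m σ)
    (g f : 𝓢(Fin d → ℝ, ℂ)) {τ : ℝ} (hτ : τ ∈ Set.Icc (0 : ℝ) 1)
    (z : (Fin d → ℝ) × (Fin d → ℝ)) :
    sqNorm g * vOpTau τ σ g f z.1 z.2 =
      ∫ w : (Fin d → ℝ) × (Fin d → ℝ), stft g f w.1 w.2 *
        (ph (-((z - w).2 ⬝ᵥ (tauMid τ z w).1)) *
          gab σ (sympL (z - w)) (tauMid τ z w) (tauPair g hτ)) := by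
  have hs : Continuous fun w : (Fin d → ℝ) × (Fin d → ℝ) => stft g f w.1 w.2 :=
    continuous_stft g f
  have hσc := hσ.1.continuous
  have hm := continuous_tauMid τ z
  have hpc := continuous_pft (tauPair g hτ)
  obtain ⟨C₀, hC₀⟩ := hσ.exists_bound
  obtain ⟨C, hC, hb⟩ := exists_symbol_mul_pft_bound hC₀
    (Bornology.isVonNBounded_singleton (𝕜 := ℝ) (tauPair g hτ))
  have hw : Integrable fun w : (Fin d → ℝ) × (Fin d → ℝ) =>
      ‖stft g f w.1 w.2‖ * (C * jb2 (tauMid τ z w) ^ m) := by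
    refine ((integrable_stft_mul_pow g f ⌈|m|⌉₊).const_mul
      (C * ((2 * (1 + 2 * d)) ^ |m| * (jb2 z ^ m * (1 + ‖z‖) ^ |m|)))).mono' ?_
      (Filter.Eventually.of_forall fun w => ?_)
    · refine Continuous.aestronglyMeasurable (hs.norm.mul (continuous_const.mul ?_))
      exact (continuous_jb2.comp hm).rpow_const fun w => Or.inl (jb2_pos _).ne'
    · have hj := Real.rpow_nonneg (jb2_pos z).le m
      have hj' := Real.rpow_nonneg (jb2_pos (tauMid τ z w)).le m
      have h1 : (1 + ‖z - w‖) ^ |m| ≤ (1 + ‖z‖) ^ |m| * (1 + ‖w‖) ^ ⌈|m|⌉₊ := by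
        calc (1 + ‖z - w‖) ^ |m| ≤ ((1 + ‖z‖) * (1 + ‖w‖)) ^ |m| := by
              gcongr
              nlinarith [norm_sub_le z w, norm_nonneg z, norm_nonneg w]
          _ = (1 + ‖z‖) ^ |m| * (1 + ‖w‖) ^ |m| :=
              Real.mul_rpow (by positivity) (by positivity)
          _ ≤ _ := by
              rw [← Real.rpow_natCast]
              gcongr
              · linarith [norm_nonneg w]
              · exact Nat.le_ceil _
      rw [Real.norm_of_nonneg (by positivity)]
      calc ‖stft g f w.1 w.2‖ * (C * jb2 (tauMid τ z w) ^ m)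
          ≤ ‖stft g f w.1 w.2‖ * (C * ((2 * (1 + 2 * d)) ^ |m| *
              (jb2 z ^ m * ((1 + ‖z‖) ^ |m| * (1 + ‖w‖) ^ ⌈|m|⌉₊)))) := by
            gcongr
            refine (jb2_tauMid_rpow_le hτ m z w).trans ?_
            gcongr
        _ = _ := by ring
  have hprod : Integrable (Function.uncurry fun (w p : (Fin d → ℝ) × (Fin d → ℝ)) =>
      σ p * (stft g f w.1 w.2 *
        (ph (-((z - w).2 ⬝ᵥ (tauMid τ z w).1)) * (ph (sympL (z - w) (p - tauMid τ z w)) *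
          pft (tauPair g hτ) (p - tauMid τ z w))))) (volume.prod volume) := by
    refine integrable_uncurry_of_norm_le_shift ?_ hw integrable_bump2 (s := tauMid τ z)
      fun w p => ?_
    · simp only [sympL_apply, Function.uncurry_def]
      have hs' : Continuous fun q : ((Fin d → ℝ) × (Fin d → ℝ)) × ((Fin d → ℝ) × (Fin d → ℝ)) =>
        stft g f q.1.1 q.1.2 := hs.comp continuous_fst
      refine Continuous.aestronglyMeasurable (Continuous.mul (by fun_prop) (hs'.mul ?_))
      fun_prop
    · rw [norm_mul, norm_mul, norm_mul, norm_mul, norm_ph, norm_ph, one_mul, one_mul]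
      have := hb _ rfl (tauMid τ z w) (p - tauMid τ z w)
      rw [sub_add_cancel] at this
      calc ‖σ p‖ * (‖stft g f w.1 w.2‖ * ‖pft (tauPair g hτ) (p - tauMid τ z w)‖)
          = ‖stft g f w.1 w.2‖ * (‖σ p‖ * ‖pft (tauPair g hτ) (p - tauMid τ z w)‖) := by ring
        _ ≤ ‖stft g f w.1 w.2‖ * (C * jb2 (tauMid τ z w) ^ m * bump2 (p - tauMid τ z w)) := by
            gcongr
        _ = _ := by ring
  rw [vOpTau, ← integral_const_mul]
  calc ∫ p, sqNorm g * (σ p * (starRingEnd ℂ) (wig τ (tshift z g) f p))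
      = ∫ p, ∫ w : (Fin d → ℝ) × (Fin d → ℝ), σ p * (stft g f w.1 w.2 *
        (ph (-((z - w).2 ⬝ᵥ (tauMid τ z w).1)) * (ph (sympL (z - w) (p - tauMid τ z w)) *
          pft (tauPair g hτ) (p - tauMid τ z w)))) := by
        refine integral_congr_ae (Filter.Eventually.of_forall fun p => ?_)
        simp only
        rw [mul_left_comm, sqNorm_mul_conj_wig g f hτ, integral_const_mul]
    _ = ∫ w : (Fin d → ℝ) × (Fin d → ℝ), ∫ p, σ p * (stft g f w.1 w.2 *
        (ph (-((z - w).2 ⬝ᵥ (tauMid τ z w).1)) * (ph (sympL (z - w) (p - tauMid τ z w)) *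
          pft (tauPair g hτ) (p - tauMid τ z w)))) :=
        (integral_integral_swap hprod).symm
    _ = _ := by
        refine integral_congr_ae (Filter.Eventually.of_forall fun w => ?_)
        simp only
        rw [← integral_add_right_eq_self _ (tauMid τ z w), gab, ← integral_const_mul,
          ← integral_const_mul]
        refine integral_congr_ae (Filter.Eventually.of_forall fun p => ?_)
        simp only [add_sub_cancel_right]
        ring

theorem exists_vOpTau_bound {m : ℝ} {σ : (Fin d → ℝ) × (Fin d → ℝ) → ℂ} (hσ : SmSymbol d m σ)
    {g : 𝓢(Fin d → ℝ, ℂ)} (hg : g ≠ 0) (M : ℝ) :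
    ∃ C : ℝ≥0∞, C ≠ ∞ ∧ ∀ τ ∈ Set.Icc (0 : ℝ) 1, ∀ (f : 𝓢(Fin d → ℝ, ℂ))
      (z : (Fin d → ℝ) × (Fin d → ℝ)), ‖Function.uncurry (vOpTau τ σ g f) z‖ₑ ≤
        C * ENNReal.ofReal (jb2 z ^ m) *
          ∫⁻ w, ‖Function.uncurry (stft g f) w‖ₑ * dec M (z - w) := by
  obtain ⟨D, hD, h⟩ := exists_gab_decay hσ (isVonNBounded_tauPair g) ⌈M + |m|⌉₊
  have hK : 0 ≤ D * (2 * (1 + 2 * d)) ^ |m| := by positivity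
  refine ⟨ENNReal.ofReal (D * (2 * (1 + 2 * d)) ^ |m| / ‖sqNorm g‖), ENNReal.ofReal_ne_top,
    fun τ hτ f z => ?_⟩
  have hj := Real.rpow_nonneg (jb2_pos z).le m
  rw [← ENNReal.ofReal_mul (by positivity), div_mul_eq_mul_div]
  refine enorm_le_of_mul_eq_integral (sqNorm_ne_zero hg) (sqNorm_mul_vOpTau hσ g f hτ z)
    (by positivity) fun w => ?_
  rw [norm_mul, norm_mul, norm_ph, one_mul, mul_comm]
  refine mul_le_mul_of_nonneg_right ?_ (norm_nonneg _)
  refine (le_rpow_neg_of_pow_mul_le (norm_nonneg (z - w)) (norm_nonneg _)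
    (h _ ⟨⟨τ, hτ⟩, rfl⟩ _ _)).trans ?_
  calc D * jb2 (tauMid τ z w) ^ m * (1 + ‖z - w‖) ^ (-(M + |m|))
      ≤ D * ((2 * (1 + 2 * d)) ^ |m| * (jb2 z ^ m * (1 + ‖z - w‖) ^ |m|)) *
          (1 + ‖z - w‖) ^ (-(M + |m|)) := by
        gcongr; exact jb2_tauMid_rpow_le hτ m z w
    _ = D * (2 * (1 + 2 * d)) ^ |m| * jb2 z ^ m *
          ((1 + ‖z - w‖) ^ |m| * (1 + ‖z - w‖) ^ (-(M + |m|))) := by ring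
    _ = _ := by
        rw [← Real.rpow_add (by positivity)]
        congr 2; ring

end BoundednessProof

open scoped ENNReal in
/-- Boundedness of `τ`-pseudodifferential operators with symbols in `S^m` from
`M^{p,q}_{⟨·⟩^{r+m}}(ℝ^d)` to `M^{p,q}_{⟨·⟩^r}(ℝ^d)`, uniformly in `τ ∈ [0,1]`,
stated on the dense class of Schwartz functions. Here `G(g,Λ)` is assumed to be a
Gabor frame for `L²(ℝ^d)` over the lattice `Λ = A(ℤ^{2d})`. -/
theorem opTau_bounded_modulation (d : ℕ) (m r : ℝ) (p q : ℝ≥0∞) (hp : p ≠ 0) (hq : q ≠ 0)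
    (g : SchwartzMap (Fin d → ℝ) ℂ) (hg : g ≠ 0)
    (A : ((Fin d → ℝ) × (Fin d → ℝ)) ≃ₗ[ℝ] ((Fin d → ℝ) × (Fin d → ℝ)))
    (hframe : ∃ CA CB : ℝ, 0 < CA ∧ 0 < CB ∧
      ∀ f : SchwartzMap (Fin d → ℝ) ℂ,
        (CA * ∫ t : Fin d → ℝ, ‖f t‖ ^ 2) ≤
            (∑' k : (Fin d → ℤ) × (Fin d → ℤ),
              ‖∫ t : Fin d → ℝ, f t *
                (starRingEnd ℂ)
                  (tshift (A ((fun i => (k.1 i : ℝ)), fun i => (k.2 i : ℝ))) (⇑g) t)‖ ^ 2) ∧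
          (∑' k : (Fin d → ℤ) × (Fin d → ℤ),
              ‖∫ t : Fin d → ℝ, f t *
                (starRingEnd ℂ)
                  (tshift (A ((fun i => (k.1 i : ℝ)), fun i => (k.2 i : ℝ))) (⇑g) t)‖ ^ 2) ≤
            CB * ∫ t : Fin d → ℝ, ‖f t‖ ^ 2)
    (σ : (Fin d → ℝ) × (Fin d → ℝ) → ℂ) (hσ : SmSymbol d m σ) :
    ∃ C : ℝ≥0∞, C ≠ ⊤ ∧ ∀ τ ∈ Set.Icc (0 : ℝ) 1, ∀ f : SchwartzMap (Fin d → ℝ) ℂ,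
      mixedModNorm p q r (vOpTau τ σ (⇑g) (⇑f)) ≤
        C * mixedModNorm p q (r + m) (stft (⇑g) (⇑f)) := by
  obtain ⟨M, hM⟩ := mixedModNorm_le_of_kernel (d := d) m r hp hq
  obtain ⟨C₁, hC₁, h₁⟩ := exists_stft_reproducing hg M
  obtain ⟨C₂, hC₂, h₂⟩ := exists_vOpTau_bound hσ hg M
  obtain ⟨C, hC, h⟩ := hM C₁ C₂ hC₁ hC₂
  exact ⟨C, hC, fun τ hτ f => h _ _ (continuous_stft g f) (lintegral_stft_ne_top g f) (h₁ f)
    (h₂ τ hτ f)⟩
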